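/- Let M ⊆ ℂ^N be a connected Stein manifold of complex dimension n+1 (n ≥ 1), let B ⊆ ℂ^n be a connected open set, and let p : M → B be a holomorphic submersion such that the Betti numbers b_0(t) and b_1(t) of the fibre p^{-1}(t) are finite for all t ∈ B. Then the top Betti number t ↦ b_1(t) is lower semi-continuous: for every λ ∈ B there is a neighborhood B' of λ such that b_1(t) ≥ b_1(λ) for all t ∈ B'. -/

import Mathlib

open Filter Set Topology

noncomputable section

/-- The singular chain complex of a topological space, with `ℚ` coefficients:
the alternating face map complex of the free simplicial `ℚ`-module on the
singular simplicial set. -/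
def singularChainComplex (X : Type) [TopologicalSpace X] : ChainComplex (ModuleCat ℚ) ℕ :=
  (AlgebraicTopology.alternatingFaceMapComplex (ModuleCat ℚ)).obj
    (((CategoryTheory.SimplicialObject.whiskering (Type) (ModuleCat ℚ)).obj
      (ModuleCat.free ℚ)).obj (TopCat.toSSet.obj (TopCat.of X)))

/-- Singular homology of a topological space with `ℚ` coefficients. -/
def singularHomology (X : Type) [TopologicalSpace X] (i : ℕ) : ModuleCat ℚ :=
  (singularChainComplex X).homology i

/-- The `i`-th Betti number: the dimension over `ℚ` of the `i`-th singular
homology with `ℚ` coefficients. -/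
def bettiNumber (X : Type) [TopologicalSpace X] (i : ℕ) : ℕ :=
  Module.finrank ℚ (singularHomology X i)

/-- The `i`-th Betti number is finite. -/
def FiniteBetti (X : Type) [TopologicalSpace X] (i : ℕ) : Prop :=
  FiniteDimensional ℚ (singularHomology X i)

/-- `Φ` and `Ψ` give mutually inverse smooth maps between `S ⊆ E` and `T ⊆ F`,
i.e. a diffeomorphism between `S` and `T` (smoothness of a map on a subset is
expressed via `ContDiffOn`). -/
def IsDiffeoOn {E F : Type} [NormedAddCommGroup E] [NormedSpace ℝ E]
    [NormedAddCommGroup F] [NormedSpace ℝ F]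
    (Φ : E → F) (Ψ : F → E) (S : Set E) (T : Set F) : Prop :=
  ContDiffOn ℝ (⊤ : ℕ∞) Φ S ∧ ContDiffOn ℝ (⊤ : ℕ∞) Ψ T ∧ Set.MapsTo Φ S T ∧ Set.MapsTo Ψ T S ∧
    Set.LeftInvOn Ψ Φ S ∧ Set.RightInvOn Ψ Φ T

/-- `S` and `T` are diffeomorphic. -/
def DiffeoEquiv {E F : Type} [NormedAddCommGroup E] [NormedSpace ℝ E]
    [NormedAddCommGroup F] [NormedSpace ℝ F] (S : Set E) (T : Set F) : Prop :=
  ∃ Φ Ψ, IsDiffeoOn Φ Ψ S T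

/-- The restriction of `p` to `M` is a trivial smooth fibration over `D` with fibre
`p⁻¹(lam) ∩ M`: there is a diffeomorphism `Φ : M ∩ p⁻¹(D) → D × (M ∩ p⁻¹(lam))`
with `pr₁ ∘ Φ = p`. -/
def IsSmoothTrivialFibrationOn {E F : Type} [NormedAddCommGroup E] [NormedSpace ℝ E]
    [NormedAddCommGroup F] [NormedSpace ℝ F]
    (p : E → F) (M : Set E) (D : Set F) (lam : F) : Prop :=
  ∃ Φ : E → F × E, ∃ Ψ : F × E → E,
    IsDiffeoOn Φ Ψ (M ∩ p ⁻¹' D) (D ×ˢ (M ∩ p ⁻¹' {lam})) ∧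
    ∀ x ∈ M ∩ p ⁻¹' D, (Φ x).1 = p x

/-- `lam` is not a bifurcation value of `p : M → B`. -/
def IsNotBifurcationValueOn {E F : Type} [NormedAddCommGroup E] [NormedSpace ℝ E]
    [NormedAddCommGroup F] [NormedSpace ℝ F]
    (p : E → F) (M : Set E) (B : Set F) (lam : F) : Prop :=
  ∃ D : Set F, IsOpen D ∧ lam ∈ D ∧ D ⊆ B ∧ IsSmoothTrivialFibrationOn p M D lam

/-- `g : V → ℂᵏ` is a holomorphic local defining function for `M` at `x`, with
surjective derivative at every point of its zero set. -/
def IsLocalDefiningFunction {E : Type} [NormedAddCommGroup E] [NormedSpace ℂ E]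
    (k : ℕ) (M : Set E) (x : E) (V : Set E) (g : E → (Fin k → ℂ)) : Prop :=
  IsOpen V ∧ x ∈ V ∧ DifferentiableOn ℂ g V ∧
    (∀ y ∈ V, g y = 0 → Function.Surjective (fderiv ℂ g y)) ∧
    M ∩ V = {y ∈ V | g y = 0}

/-- `M ⊆ ℂᴺ` is a (Stein) closed complex submanifold of complex dimension `m`:
it is closed and near each of its points it is the zero set of a holomorphic
submersion to `ℂ^{N-m}`. -/
def IsSteinSubmanifold (N m : ℕ) (M : Set (Fin N → ℂ)) : Prop :=
  IsClosed M ∧ ∀ x ∈ M, ∃ V g, IsLocalDefiningFunction (N - m) M x V g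

/-- A holomorphic map `p` (defined near `M`) is a submersion at `x ∈ M`: its
derivative maps the tangent space `T_x M = ker (d_x g)` onto the target, where
`g` is a local defining function of `M` near `x` (of codimension `k`). -/
def SubmersionAt {E F : Type} [NormedAddCommGroup E] [NormedSpace ℂ E]
    [NormedAddCommGroup F] [NormedSpace ℂ F]
    (k : ℕ) (M : Set E) (p : E → F) (x : E) : Prop :=
  ∃ V g, IsLocalDefiningFunction k M x V g ∧
    Submodule.map (fderiv ℂ p x).toLinearMap
      (LinearMap.ker (fderiv ℂ g x).toLinearMap) = ⊤

/-- A connected component of the fibres of `p : M → B` vanishes at infinity as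
`t → lam`: there are `t k → lam` in `B` and connected components
`C k = connectedComponentIn (M ∩ p⁻¹(t k)) (x k)` of the fibres over `t k`
which eventually miss every compact subset. -/
def HasVanishingComponentAtInfinity {E F : Type} [TopologicalSpace E] [TopologicalSpace F]
    (M : Set E) (p : E → F) (B : Set F) (lam : F) : Prop :=
  ∃ t : ℕ → F, ∃ x : ℕ → E,
    (∀ k, t k ∈ B) ∧ Filter.Tendsto t Filter.atTop (nhds lam) ∧
    (∀ k, x k ∈ M ∩ p ⁻¹' {t k}) ∧
    ∀ K : Set E, IsCompact K →
      ∀ᶠ k in Filter.atTop, connectedComponentIn (M ∩ p ⁻¹' {t k}) (x k) ∩ K = ∅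

/-- `Φ` and `Ψ` give mutually inverse continuous maps between `S` and `T`,
i.e. a homeomorphism between `S` and `T`. -/
def IsHomeoOn {E F : Type} [TopologicalSpace E] [TopologicalSpace F]
    (Φ : E → F) (Ψ : F → E) (S : Set E) (T : Set F) : Prop :=
  ContinuousOn Φ S ∧ ContinuousOn Ψ T ∧ Set.MapsTo Φ S T ∧ Set.MapsTo Ψ T S ∧
    Set.LeftInvOn Ψ Φ S ∧ Set.RightInvOn Ψ Φ T

/-- The Euler characteristic `b₀ - b₁` of the fibre of `p : M → ·` over `t`
(the fibres under consideration are open curves, with no homology in degrees ≥ 2). -/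
def eulerCharOn {E F : Type} [TopologicalSpace E] (p : E → F) (M : Set E) (t : F) : ℤ :=
  (bettiNumber ↥(M ∩ p ⁻¹' {t}) 0 : ℤ) - (bettiNumber ↥(M ∩ p ⁻¹' {t}) 1 : ℤ)


section
open Filter Set Topology
noncomputable section
set_option linter.unusedSectionVars false
namespace AS

section base
variable {T T' V : Type*} [AddCommGroup V]

def IsCoc [TopologicalSpace T] (A : T → T → V) (S : Set T) : Prop :=
  ∀ x ∈ S, ∃ U ∈ 𝓝[S] x, ∀ a ∈ U, ∀ b ∈ U, ∀ c ∈ U, A a b + A b c = A a c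

def IsPrim [TopologicalSpace T] (A : T → T → V) (g : T → V) (S : Set T) : Prop :=
  ∀ x ∈ S, ∃ U ∈ 𝓝[S] x, ∀ a ∈ U, ∀ b ∈ U, A a b = g b - g a

def LocEq [TopologicalSpace T] (A B : T → T → V) (S : Set T) : Prop :=
  ∀ x ∈ S, ∃ U ∈ 𝓝[S] x, ∀ a ∈ U, ∀ b ∈ U, A a b = B a b

theorem IsCoc.pull [TopologicalSpace T] [TopologicalSpace T'] {A : T → T → V} {S : Set T}
    (h : IsCoc A S) {f : T' → T} {S' : Set T'} (hf : ContinuousOn f S') (hm : MapsTo f S' S) :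
    IsCoc (fun a b => A (f a) (f b)) S' := by
  intro x hx
  obtain ⟨U, hU, hc⟩ := h (f x) (hm hx)
  exact ⟨f ⁻¹' U, (hf x hx).tendsto_nhdsWithin hm hU,
    fun a ha b hb c hc' => hc _ ha _ hb _ hc'⟩

theorem IsPrim.pull [TopologicalSpace T] [TopologicalSpace T'] {A : T → T → V} {g : T → V}
    {S : Set T} (h : IsPrim A g S) {f : T' → T} {S' : Set T'} (hf : ContinuousOn f S')
    (hm : MapsTo f S' S) :
    IsPrim (fun a b => A (f a) (f b)) (fun a => g (f a)) S' := by
  intro x hx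
  obtain ⟨U, hU, hc⟩ := h (f x) (hm hx)
  exact ⟨f ⁻¹' U, (hf x hx).tendsto_nhdsWithin hm hU, fun a ha b hb => hc _ ha _ hb⟩

theorem IsCoc.mono [TopologicalSpace T] {A : T → T → V} {S S' : Set T}
    (h : IsCoc A S) (hs : S' ⊆ S) : IsCoc A S' :=
  h.pull (f := id) continuousOn_id hs

theorem IsPrim.mono [TopologicalSpace T] {A : T → T → V} {g : T → V} {S S' : Set T}
    (h : IsPrim A g S) (hs : S' ⊆ S) : IsPrim A g S' :=
  h.pull (f := id) continuousOn_id hs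

theorem LocEq.mono [TopologicalSpace T] {A B : T → T → V} {S S' : Set T}
    (h : LocEq A B S) (hs : S' ⊆ S) : LocEq A B S' := by
  intro x hx
  obtain ⟨U, hU, h⟩ := h x (hs hx)
  exact ⟨U, nhdsWithin_mono x hs hU, h⟩

theorem LocEq.trans [TopologicalSpace T] {A B C : T → T → V} {S : Set T}
    (h : LocEq A B S) (h' : LocEq B C S) : LocEq A C S := by
  intro x hx
  obtain ⟨U, hU, h⟩ := h x hx
  obtain ⟨U', hU', h'⟩ := h' x hx
  exact ⟨U ∩ U', inter_mem hU hU', fun a ha b hb => (h a ha.1 b hb.1).trans (h' a ha.2 b hb.2)⟩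

theorem LocEq.symm [TopologicalSpace T] {A B : T → T → V} {S : Set T}
    (h : LocEq A B S) : LocEq B A S := by
  intro x hx
  obtain ⟨U, hU, h⟩ := h x hx
  exact ⟨U, hU, fun a ha b hb => (h a ha b hb).symm⟩

theorem IsCoc.congr [TopologicalSpace T] {A B : T → T → V} {S : Set T}
    (h : IsCoc A S) (h' : LocEq B A S) : IsCoc B S := by
  intro x hx
  obtain ⟨U, hU, h⟩ := h x hx
  obtain ⟨U', hU', h'⟩ := h' x hx
  refine ⟨U ∩ U', inter_mem hU hU', fun a ha b hb c hc => ?_⟩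
  rw [h' a ha.2 b hb.2, h' b hb.2 c hc.2, h' a ha.2 c hc.2]
  exact h a ha.1 b hb.1 c hc.1

theorem IsPrim.congr [TopologicalSpace T] {A B : T → T → V} {g : T → V} {S : Set T}
    (h : IsPrim A g S) (h' : LocEq B A S) : IsPrim B g S := by
  intro x hx
  obtain ⟨U, hU, h⟩ := h x hx
  obtain ⟨U', hU', h'⟩ := h' x hx
  refine ⟨U ∩ U', inter_mem hU hU', fun a ha b hb => ?_⟩
  rw [h' a ha.2 b hb.2, h a ha.1 b hb.1]

theorem IsPrim.unique [TopologicalSpace T] {A : T → T → V} {g h : T → V} {S : Set T}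
    (hg : IsPrim A g S) (hh : IsPrim A h S) (hS : IsPreconnected S) {x y : T} (hx : x ∈ S)
    (hy : y ∈ S) : g y - g x = h y - h x := by
  let _ : TopologicalSpace V := ⊥
  have : DiscreteTopology V := ⟨rfl⟩
  have hc : ContinuousOn (fun z => g z - h z) S := by
    intro z hz
    obtain ⟨U, hU, h1⟩ := hg z hz
    obtain ⟨U', hU', h2⟩ := hh z hz
    have hzU := mem_of_mem_nhdsWithin hz hU
    have hzU' := mem_of_mem_nhdsWithin hz hU'
    refine ContinuousWithinAt.congr_of_eventuallyEq
      (continuousWithinAt_const (b := g z - h z)) ?_ rfl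
    filter_upwards [hU, hU'] with w hw hw'
    have e1 := h1 z hzU w hw
    have e2 := h2 z hzU' w hw'
    rw [e1] at e2
    rw [sub_eq_sub_iff_add_eq_add] at e2 ⊢
    rw [e2, add_comm]
  have : g x - h x = g y - h y := hS.constant hc hx hy
  rw [sub_eq_sub_iff_add_eq_add] at this ⊢
  rw [← this, add_comm]

theorem prim_of_strict [TopologicalSpace T] {A : T → T → V} {S U : Set T} (hSU : S ⊆ U)
    (h : ∀ a ∈ U, ∀ b ∈ U, ∀ c ∈ U, A a b + A b c = A a c) {c : T} (hc : c ∈ U) :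
    IsPrim A (fun x => A c x) S := by
  intro x hx
  refine ⟨S, self_mem_nhdsWithin, fun a ha b hb => ?_⟩
  change A a b = A c b - A c a
  rw [← h c hc a (hSU ha) b (hSU hb)]; abel

theorem strict_self {A : T → T → V} {U : Set T}
    (h : ∀ a ∈ U, ∀ b ∈ U, ∀ c ∈ U, A a b + A b c = A a c) {c : T} (hc : c ∈ U) : A c c = 0 := by
  simpa using h c hc c hc c hc

theorem IsPrim.strict [TopologicalSpace T] {A : T → T → V} {g : T → V} {S U : Set T}
    (hg : IsPrim A g S) (hS : IsPreconnected S) (hSU : S ⊆ U)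
    (h : ∀ a ∈ U, ∀ b ∈ U, ∀ c ∈ U, A a b + A b c = A a c) {c d : T} (hc : c ∈ S) (hd : d ∈ S) :
    g d - g c = A c d := by
  rw [hg.unique (prim_of_strict hSU h (hSU hc)) hS hc hd, strict_self h (hSU hc), sub_zero]

theorem IsCoc.unif [PseudoMetricSpace T] {A : T → T → V} {S K : Set T} (h : IsCoc A S)
    (hK : IsCompact K) (hKS : K ⊆ S) :
    ∃ δ > 0, ∀ x ∈ K, ∀ a ∈ S ∩ Metric.ball x δ, ∀ b ∈ S ∩ Metric.ball x δ,
      ∀ c ∈ S ∩ Metric.ball x δ, A a b + A b c = A a c := by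
  have : ∀ x : K, ∃ O, IsOpen O ∧ (x : T) ∈ O ∧ ∀ a ∈ S ∩ O, ∀ b ∈ S ∩ O,
      ∀ c ∈ S ∩ O, A a b + A b c = A a c := by
    rintro ⟨x, hx⟩
    obtain ⟨U, hU, hc⟩ := h x (hKS hx)
    obtain ⟨O, hO, hxO, hOU⟩ := mem_nhdsWithin.1 hU
    exact ⟨O, hO, hxO, fun a ha b hb c hc' =>
      hc a (hOU ha.symm) b (hOU hb.symm) c (hOU hc'.symm)⟩
  choose O hO hxO hc using this
  obtain ⟨δ, hδ, hb⟩ := lebesgue_number_lemma_of_metric hK hO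
    (fun x hx => mem_iUnion.2 ⟨⟨x, hx⟩, hxO ⟨x, hx⟩⟩)
  refine ⟨δ, hδ, fun x hx a ha b hb' c hc' => ?_⟩
  obtain ⟨i, hi⟩ := hb x hx
  exact hc i a ⟨ha.1, hi ha.2⟩ b ⟨hb'.1, hi hb'.2⟩ c ⟨hc'.1, hi hc'.2⟩

theorem telesc {n : ℕ} {ta tb c : ℕ → V} (h : ∀ i < n, ta i + c (i + 1) = c i + tb i) :
    ∑ i ∈ Finset.range n, tb i - ∑ i ∈ Finset.range n, ta i = c n - c 0 := by
  rw [← Finset.sum_range_sub, ← Finset.sum_sub_distrib]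
  apply Finset.sum_congr rfl
  intro i hi
  have := h i (Finset.mem_range.1 hi)
  rw [sub_eq_sub_iff_add_eq_add]
  rw [add_comm, ← this, add_comm]

theorem IsCoc.interval {A : ℝ → ℝ → V} (h : IsCoc A (Icc 0 1)) : ∃ g, IsPrim A g (Icc 0 1) := by
  obtain ⟨δ, hδ, hd⟩ := h.unif isCompact_Icc subset_rfl
  obtain ⟨n, hn⟩ := exists_nat_gt (2 / δ)
  have hn0 : (0 : ℝ) < n := lt_trans (by positivity) hn
  have hnn : n ≠ 0 := by rintro rfl; simp at hn0
  have h1n : 1 / (n : ℝ) < δ / 2 := by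
    rw [div_lt_iff₀ hδ] at hn; rw [div_lt_iff₀ hn0]; linarith
  refine ⟨fun s => ∑ i ∈ Finset.range n, A (i / n * s) ((i + 1 : ℕ) / n * s), ?_⟩
  intro x hx
  refine ⟨Icc 0 1 ∩ Metric.ball x (δ / 4), inter_mem self_mem_nhdsWithin
    (mem_nhdsWithin_of_mem_nhds (Metric.ball_mem_nhds _ (by positivity))), ?_⟩
  rintro a ⟨ha, hax⟩ b ⟨hb, hbx⟩
  have hab : |a - b| < δ / 2 := by
    rw [Metric.mem_ball, Real.dist_eq] at hax hbx
    rw [abs_lt] at *; constructor <;> linarith [hax.1, hax.2, hbx.1, hbx.2]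
  have key := telesc (n := n) (ta := fun i => A (i / n * a) ((i + 1 : ℕ) / n * a))
    (tb := fun i => A (i / n * b) ((i + 1 : ℕ) / n * b))
    (c := fun i => A (i / n * a) (i / n * b)) ?_
  · rw [key]
    have h0 : A 0 0 = 0 := by
      have : (0:ℝ) ∈ Icc (0:ℝ) 1 ∩ Metric.ball 0 δ := ⟨by simp, by simpa⟩
      simpa using hd 0 (by simp) 0 this 0 this 0 this
    simp [hn0.ne', h0]
  · intro i hi
    have hin : (i + 1 : ℝ) ≤ n := by exact_mod_cast hi
    have mem : ∀ k : ℕ, k ≤ i + 1 → i ≤ k → ∀ s ∈ Icc (0:ℝ) 1, |a - s| < δ / 2 →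
        (k / n * s : ℝ) ∈ Icc (0:ℝ) 1 ∩ Metric.ball (i / n * a) δ := by
      intro k hk hik s hs has
      have hk' : (k : ℝ) ≤ i + 1 := by exact_mod_cast hk
      have hk2 : (i : ℝ) ≤ k := by exact_mod_cast hik
      have e0 : 0 ≤ (k / n : ℝ) := by positivity
      have e1 : (k / n : ℝ) ≤ 1 := by rw [div_le_one hn0]; linarith
      have e2 : (k / n : ℝ) - i / n ≤ 1 / n := by
        rw [← sub_div]; apply div_le_div_of_nonneg_right _ hn0.le; linarith
      have e3 : 0 ≤ (k / n : ℝ) - i / n := by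
        rw [← sub_div]; apply div_nonneg _ hn0.le; linarith
      refine ⟨⟨mul_nonneg e0 hs.1, mul_le_one₀ e1 hs.1 hs.2⟩, ?_⟩
      rw [Metric.mem_ball, Real.dist_eq]
      have : (k / n * s - i / n * a : ℝ) = k / n * (s - a) + (k / n - i / n) * a := by ring
      rw [this]
      calc |_| ≤ |k / n * (s - a)| + |(k / n - i / n) * a| := abs_add_le _ _
        _ ≤ |s - a| + (k / n - i / n) := by
          rw [abs_mul, abs_mul, abs_of_nonneg e0, abs_of_nonneg e3, abs_of_nonneg ha.1]
          exact add_le_add (mul_le_of_le_one_left (abs_nonneg _) e1)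
            (mul_le_of_le_one_right e3 ha.2)
        _ < δ := by rw [abs_sub_comm]; linarith
    have hx0 : (i / n * a : ℝ) ∈ Icc (0:ℝ) 1 := (mem i (by omega) le_rfl a ha (by simpa)).1
    have m1 := mem i (by omega) le_rfl a ha (by simpa)
    have m2 := mem (i+1) (by omega) (by omega) a ha (by simpa)
    have m3 := mem i (by omega) le_rfl b hb hab
    have m4 := mem (i+1) (by omega) (by omega) b hb hab
    rw [hd _ hx0 _ m1 _ m2 _ m4, hd _ hx0 _ m1 _ m3 _ m4]

theorem IsCoc.homotopy [PseudoMetricSpace T'] [TopologicalSpace T] {A : T → T → V}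
    {S : Set T} (hA : IsCoc A S) {S' : Set T'} (H : T' → ℝ → T)
    (hH : ContinuousOn (fun q : T' × ℝ => H q.1 q.2) (S' ×ˢ Icc 0 1))
    (hm : ∀ y ∈ S', ∀ s ∈ Icc (0:ℝ) 1, H y s ∈ S) :
    ∃ g, IsPrim (fun a b => A (H a 1) (H b 1) - A (H a 0) (H b 0)) g S' := by
  have hB := hA.pull hH (fun q hq => hm _ hq.1 _ hq.2)
  have hpr : ∀ y, ∃ h : ℝ → V, y ∈ S' → IsPrim (fun s s' => A (H y s) (H y s')) h (Icc 0 1) := by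
    intro y
    by_cases hy : y ∈ S'
    · have : IsCoc (fun s s' => A (H y s) (H y s')) (Icc 0 1) :=
        hB.pull (f := fun s => (y, s)) (by fun_prop) (fun s hs => ⟨hy, hs⟩)
      obtain ⟨h, hh⟩ := this.interval
      exact ⟨h, fun _ => hh⟩
    · exact ⟨0, fun h => absurd h hy⟩
  choose h hh using hpr
  refine ⟨fun y => h y 1 - h y 0, ?_⟩
  intro y0 hy0
  obtain ⟨δ, hδ, hd⟩ := hB.unif (K := {y0} ×ˢ Icc 0 1) (isCompact_singleton.prod isCompact_Icc)
    (prod_mono (by simpa) subset_rfl)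
  obtain ⟨n, hn⟩ := exists_nat_gt (1 / δ)
  have hn0 : (0 : ℝ) < n := lt_trans (by positivity) hn
  have h1n : 1 / (n : ℝ) < δ := by
    rw [div_lt_iff₀ hδ] at hn; rw [div_lt_iff₀ hn0]; linarith
  refine ⟨S' ∩ Metric.ball y0 δ, inter_mem self_mem_nhdsWithin
    (mem_nhdsWithin_of_mem_nhds (Metric.ball_mem_nhds _ (by positivity))), ?_⟩
  rintro a ⟨ha, hay⟩ b ⟨hb, hby⟩
  have dv : ∀ i : ℕ, i < n → (i / n : ℝ) ∈ Icc (0:ℝ) 1 := by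
    intro i hi
    have : (i : ℝ) ≤ n := by exact_mod_cast hi.le
    exact ⟨by positivity, by rwa [div_le_one hn0]⟩
  have mem : ∀ i : ℕ, i < n → ∀ y ∈ S', y ∈ Metric.ball y0 δ → ∀ s ∈ Icc (i/n : ℝ) ((i+1 : ℕ)/n),
      (y, s) ∈ S' ×ˢ Icc (0:ℝ) 1 ∩ Metric.ball (y0, (i/n : ℝ)) δ := by
    intro i hi y hy hyy s hs
    have hin : (i + 1 : ℝ) ≤ n := by exact_mod_cast hi
    have e1 : ((i+1 : ℕ)/n : ℝ) ≤ 1 := by rw [div_le_one hn0]; push_cast; linarith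
    have e2 : ((i+1 : ℕ)/n : ℝ) = i/n + 1/n := by push_cast; ring
    refine ⟨⟨hy, (dv i hi).1.trans hs.1, hs.2.trans e1⟩, ?_⟩
    rw [← ball_prod_same]
    refine ⟨hyy, ?_⟩
    rw [Metric.mem_ball, Real.dist_eq, abs_lt]
    constructor <;> linarith [hs.1, hs.2]
  have le1 : ∀ i : ℕ, (i/n : ℝ) ≤ ((i+1 : ℕ)/n : ℝ) := by
    intro i; apply div_le_div_of_nonneg_right _ hn0.le; push_cast; linarith
  have sum : ∀ y ∈ S', y ∈ Metric.ball y0 δ → h y 1 - h y 0 =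
      ∑ i ∈ Finset.range n, A (H y (i/n)) (H y ((i+1 : ℕ)/n)) := by
    intro y hy hyy
    have := Finset.sum_range_sub (fun i : ℕ => h y (i / n)) n
    simp only [Nat.cast_zero, zero_div, div_self hn0.ne'] at this
    rw [← this]
    apply Finset.sum_congr rfl
    intro i hi
    have hi' := Finset.mem_range.1 hi
    refine IsPrim.strict (A := fun s s' => A (H y s) (H y s')) (S := Icc (i/n : ℝ) ((i+1 : ℕ)/n))
      (U := Icc (i/n : ℝ) ((i+1 : ℕ)/n))
      ((hh y hy).mono (fun s hs => (mem i hi' y hy hyy s hs).1.2)) isPreconnected_Icc subset_rfl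
      ?_ ?_ ?_
    · intro s1 h1 s2 h2 s3 h3
      exact hd (y0, i/n) ⟨rfl, dv i hi'⟩ _ (mem i hi' y hy hyy s1 h1) _ (mem i hi' y hy hyy s2 h2)
        _ (mem i hi' y hy hyy s3 h3)
    · exact ⟨le_rfl, le1 i⟩
    · exact ⟨le1 i, le_rfl⟩
  have key := telesc (n := n) (ta := fun i => A (H a (i / n)) (H a ((i + 1 : ℕ) / n)))
    (tb := fun i => A (H b (i / n)) (H b ((i + 1 : ℕ) / n)))
    (c := fun i => A (H a (i / n)) (H b (i / n))) ?_
  · simp only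
    rw [sum a ha hay, sum b hb hby, key]
    simp [hn0.ne']
  · intro i hi
    have m1 := mem i hi a ha hay _ ⟨le_rfl, le1 i⟩
    have m2 := mem i hi a ha hay _ ⟨le1 i, le_rfl⟩
    have m3 := mem i hi b hb hby _ ⟨le_rfl, le1 i⟩
    have m4 := mem i hi b hb hby _ ⟨le1 i, le_rfl⟩
    have := hd (y0, i/n) ⟨rfl, dv i hi⟩
    have e1 := this _ m1 _ m2 _ m4
    have e2 := this _ m1 _ m3 _ m4
    simp only at e1 e2 ⊢
    rw [e1, e2]

theorem IsCoc.exact_of_retract [PseudoMetricSpace T'] {A : T' → T' → V}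
    {S : Set T'} (hA : IsCoc A S) (H : T' → ℝ → T')
    (hH : ContinuousOn (fun q : T' × ℝ => H q.1 q.2) (S ×ˢ Icc 0 1))
    (hm : ∀ y ∈ S, ∀ s ∈ Icc (0:ℝ) 1, H y s ∈ S) (h1 : ∀ y, H y 1 = y)
    (h0 : ∃ g, IsPrim (fun a b => A (H a 0) (H b 0)) g S) : ∃ g, IsPrim A g S := by
  obtain ⟨g, hg⟩ := hA.homotopy H hH hm
  obtain ⟨g', hg'⟩ := h0
  refine ⟨fun y => g y + g' y, fun x hx => ?_⟩
  obtain ⟨U, hU, h⟩ := hg x hx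
  obtain ⟨U', hU', h'⟩ := hg' x hx
  refine ⟨U ∩ U', inter_mem hU hU', fun a ha b hb => ?_⟩
  have e1 := h a ha.1 b hb.1
  have e2 := h' a ha.2 b hb.2
  simp only [h1] at e1 e2
  rw [e2] at e1
  rw [sub_eq_iff_eq_add] at e1
  rw [e1]; module

/-- exactness when segments to a locally constant base point stay inside -/
theorem IsCoc.exact_of_locConst {F : Type*} [NormedAddCommGroup F] [NormedSpace ℝ F]
    {A : F → F → V} {S : Set F} (hA : IsCoc A S) (b : F → F)
    (hb : ∀ x ∈ S, ∀ᶠ y in 𝓝[S] x, b y = b x)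
    (hm : ∀ y ∈ S, ∀ s ∈ Icc (0:ℝ) 1, AffineMap.lineMap (b y) y s ∈ S) : ∃ g, IsPrim A g S := by
  have hbc : ContinuousOn b S := by
    intro x hx
    exact ContinuousWithinAt.congr_of_eventuallyEq continuousWithinAt_const (hb x hx) rfl
  refine hA.exact_of_retract (fun y s => AffineMap.lineMap (b y) y s) ?_ hm (by simp) ⟨0, ?_⟩
  · simp only [AffineMap.lineMap_apply, vsub_eq_sub, vadd_eq_add]
    have : ContinuousOn (fun q : F × ℝ => b q.1) (S ×ˢ Icc 0 1) :=
      hbc.comp continuousOn_fst (fun q hq => hq.1)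
    exact (continuousOn_snd.smul (continuousOn_fst.sub this)).add this
  · intro x hx
    refine ⟨{y | b y = b x}, hb x hx, fun a ha c hc => ?_⟩
    have hbx : b x ∈ S := by simpa using hm x hx 0 (by simp)
    obtain ⟨U, hU, h⟩ := hA _ hbx
    have := strict_self h (mem_of_mem_nhdsWithin hbx hU)
    simp only [mem_ofPred_eq] at ha hc
    simpa [ha, hc] using this

theorem IsCoc.exact_convex {F : Type*} [NormedAddCommGroup F] [NormedSpace ℝ F]
    {A : F → F → V} {S : Set F} (hA : IsCoc A S) (hS : Convex ℝ S) : ∃ g, IsPrim A g S := by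
  rcases S.eq_empty_or_nonempty with rfl | ⟨x0, h0⟩
  · exact ⟨0, fun x hx => absurd hx (by simp)⟩
  · exact hA.exact_of_locConst (fun _ => x0) (by simp)
      (fun y hy s hs => hS.lineMap_mem h0 hy hs)

theorem IsCoc.exact_real {A : ℝ → ℝ → V} {S : Set ℝ} (hA : IsCoc A S) (hS : IsOpen S) :
    ∃ g, IsPrim A g S := by
  classical
  refine hA.exact_of_locConst
    (fun y => if h : (connectedComponentIn S y).Nonempty then h.some else y) ?_ ?_
  · intro x hx
    have : connectedComponentIn S x ∈ 𝓝 x :=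
      hS.connectedComponentIn.mem_nhds (mem_connectedComponentIn hx)
    filter_upwards [mem_nhdsWithin_of_mem_nhds this] with y hy
    have e := connectedComponentIn_eq hy
    have h1 : (connectedComponentIn S x).Nonempty := ⟨x, mem_connectedComponentIn hx⟩
    have h2 : (connectedComponentIn S y).Nonempty := e ▸ h1
    rw [dif_pos h1, dif_pos h2]
    congr 1
    simp only [e]
  · intro y hy s hs
    have h2 : (connectedComponentIn S y).Nonempty := ⟨y, mem_connectedComponentIn hy⟩
    simp only [dif_pos h2]
    apply connectedComponentIn_subset S y
    exact (isPreconnected_connectedComponentIn.ordConnected.convex).lineMap_mem h2.some_mem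
      (mem_connectedComponentIn hy) hs

theorem IsCoc.exact_slices {A : ℝ × ℝ → ℝ × ℝ → V} {S : Set (ℝ × ℝ)} (hA : IsCoc A S)
    (hS : IsOpen S) (hc : ∀ y, Convex ℝ {s | (s, y) ∈ S}) : ∃ g, IsPrim A g S := by
  classical
  set O : Set ℝ := Prod.snd '' S with hO
  have hOo : IsOpen O := isOpenMap_snd _ hS
  obtain ⟨sec, hsec⟩ := exists_continuous_forall_mem_convex_of_local_const
    (X := O) (t := fun y : O => {s | (s, (y : ℝ)) ∈ S}) (fun y => hc y) (by
      rintro ⟨y, ⟨q, hq, rfl⟩⟩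
      refine ⟨q.1, ?_⟩
      have : ContinuousAt (fun y' : O => (q.1, (y' : ℝ))) ⟨q.2, ⟨q, hq, rfl⟩⟩ := by fun_prop
      exact this.eventually (hS.mem_nhds hq))
  set sc : ℝ → ℝ := fun y => if h : y ∈ O then sec ⟨y, h⟩ else 0 with hsc
  have scm : ∀ y ∈ O, (sc y, y) ∈ S := by
    intro y hy
    simp only [hsc, dif_pos hy]; exact hsec ⟨y, hy⟩
  have scc : ContinuousOn sc O := by
    rw [continuousOn_iff_continuous_domRestrict]
    convert sec.continuous using 1
    ext ⟨y, hy⟩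
    simp [hsc, hy]
  have hB : IsCoc (fun y y' => A (sc y, y) (sc y', y')) O :=
    hA.pull (f := fun y => (sc y, y)) (scc.prodMk continuousOn_id) scm
  obtain ⟨g, hg⟩ := hB.exact_real hOo
  have mO : ∀ q ∈ S, q.2 ∈ O := fun q hq => ⟨q, hq, rfl⟩
  refine hA.exact_of_retract (fun q s => (AffineMap.lineMap (sc q.2) q.1 s, q.2)) ?_ ?_ (by simp)
    ⟨fun q => g q.2, ?_⟩
  · simp only [AffineMap.lineMap_apply, vsub_eq_sub, vadd_eq_add]
    have : ContinuousOn (fun q : (ℝ × ℝ) × ℝ => sc q.1.2) (S ×ˢ Icc 0 1) :=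
      scc.comp (by fun_prop) (fun q hq => mO _ hq.1)
    exact ((continuousOn_snd.smul ((continuous_fst.comp continuous_fst).continuousOn.sub
      this)).add this).prodMk (continuous_snd.comp continuous_fst).continuousOn
  · intro q hq s hs
    exact (hc q.2).lineMap_mem (scm _ (mO q hq)) hq hs
  · have := hg.pull (f := Prod.snd) continuousOn_snd mO
    simpa using this

/-- gluing -/
theorem IsCoc.glue [TopologicalSpace T] {A : T → T → V} {g : T → V} {X Y W W' : Set T}
    (hYo : ∀ x ∈ Y, Y ∈ 𝓝[X] x) (hW'o : ∀ x ∈ W', W' ∈ 𝓝[X] x)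
    (hWo : ∀ x ∈ W, W ∈ 𝓝[X] x) (hYX : Y ⊆ X)
    (hcov : X ⊆ Y ∪ W') (hcl : X ∩ closure W' ⊆ W)
    (hA : IsCoc A Y) (hg : IsPrim A g (Y ∩ W)) :
    ∃ B : T → T → V, IsCoc B X ∧ LocEq B A Y := by
  classical
  have nY : ∀ x ∈ Y, 𝓝[Y] x = 𝓝[X] x := fun x hx =>
    le_antisymm (nhdsWithin_mono _ hYX) (nhdsWithin_le_of_mem (hYo x hx))
  have nYW : ∀ x ∈ Y ∩ W, 𝓝[Y ∩ W] x = 𝓝[X] x := fun x hx =>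
    le_antisymm (nhdsWithin_mono _ (inter_subset_left.trans hYX))
      (nhdsWithin_le_of_mem (inter_mem (hYo x hx.1) (hWo x hx.2)))
  set E : T → T → V := fun a b => if a ∈ W' ∧ b ∈ W' then 0 else A a b - (g b - g a) with hE
  set B : T → T → V := fun a b => E a b + (g b - g a) with hBdef
  have hEB : IsCoc E X → IsCoc B X := by
    intro h x hx
    obtain ⟨U, hU, h⟩ := h x hx
    refine ⟨U, hU, fun a ha b hb c hc => ?_⟩
    simp only [hBdef, ← h a ha b hb c hc]; abel
  have loc : LocEq B A Y := by
    intro x hx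
    rw [nY x hx]
    by_cases hW : x ∈ W
    · obtain ⟨U, hU, h⟩ := hg x ⟨hx, hW⟩
      rw [nYW x ⟨hx, hW⟩] at hU
      refine ⟨U, hU, fun a ha b hb => ?_⟩
      simp only [hBdef, hE, h a ha b hb]
      split_ifs <;> simp
    · have : x ∉ closure W' := fun h => hW (hcl ⟨hYX hx, h⟩)
      refine ⟨(closure W')ᶜ, mem_nhdsWithin_of_mem_nhds
        (isClosed_closure.isOpen_compl.mem_nhds this), fun a ha b hb => ?_⟩
      have : a ∉ W' := fun h => ha (subset_closure h)
      simp [hBdef, hE, this]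
  refine ⟨B, ?_, loc⟩
  intro x hx
  by_cases hY : x ∈ Y
  · have := hA.congr loc x hY
    rwa [nY x hY] at this
  · have hW' : x ∈ W' := (hcov hx).resolve_left hY
    refine ⟨W', hW'o x hW', fun a ha b hb c hc => ?_⟩
    simp [hBdef, hE, ha, hb, hc]

end base
end AS
end
end

section
open Filter Set Topology
noncomputable section
namespace AS
open CategoryTheory Simplicial Opposite

abbrev Dl (k : ℕ) := stdSimplex ℝ (Fin (k + 1))

def dface {X : Type} [TopologicalSpace X] {k : ℕ} (i : Fin (k + 2)) (τ : C(Dl (k+1), X)) :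
    C(Dl k, X) :=
  τ.comp ⟨stdSimplex.map i.succAbove, stdSimplex.continuous_map _⟩

variable (X : Type) [TopologicalSpace X]

def eqv (k : ℕ) : (TopCat.toSSet.obj (TopCat.of X)) _⦋k⦌ ≃ C(Dl k, X) :=
  TopCat.toSSetObjEquiv (TopCat.of X) (op ⦋k⦌)

theorem eqv_δ (k : ℕ) (i : Fin (k + 2)) (s : (TopCat.toSSet.obj (TopCat.of X)) _⦋k+1⦌) :
    eqv X k ((TopCat.toSSet.obj (TopCat.of X)).δ i s) = dface i (eqv X (k+1) s) := rfl

def single (k : ℕ) (s : (TopCat.toSSet.obj (TopCat.of X)) _⦋k⦌) : (singularChainComplex X).X k :=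
  (Finsupp.single s (1 : ℚ) : (TopCat.toSSet.obj (TopCat.of X)) _⦋k⦌ →₀ ℚ)

theorem hom_sum_apply {A B : ModuleCat ℚ} {m : ℕ} (f : Fin m → (A ⟶ B)) (x : A) :
    (∑ i : Fin m, (-1 : ℤ) ^ (i : ℕ) • f i).hom x = ∑ i : Fin m, (-1 : ℤ) ^ (i : ℕ) • (f i).hom x := by
  rw [ModuleCat.hom_sum, LinearMap.sum_apply]
  apply Finset.sum_congr rfl
  intro i _
  rw [ModuleCat.hom_zsmul, LinearMap.smul_apply]

theorem d_single (k : ℕ) (s : (TopCat.toSSet.obj (TopCat.of X)) _⦋k+1⦌) :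
    ((singularChainComplex X).d (k+1) k).hom (single X (k+1) s) =
      ∑ i : Fin (k + 2), (-1 : ℤ) ^ (i : ℕ) • single X k ((TopCat.toSSet.obj (TopCat.of X)).δ i s) := by
  have : (singularChainComplex X).d (k+1) k = _ := AlgebraicTopology.AlternatingFaceMapComplex.obj_d_eq _ k
  refine (congrArg (fun g => ModuleCat.Hom.hom g (single X (k+1) s)) this).trans ?_
  refine (hom_sum_apply _ _).trans ?_
  apply Finset.sum_congr rfl
  intro i _
  congr 1
  exact Finsupp.mapDomain_single

def toLin (k : ℕ) {V : Type} [AddCommGroup V] [Module ℚ V] (α : C(Dl k, X) → V) :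
    (singularChainComplex X).X k →ₗ[ℚ] V :=
  (Finsupp.lift V ℚ ((TopCat.toSSet.obj (TopCat.of X)) _⦋k⦌) (fun s => α (eqv X k s)) :
    ((TopCat.toSSet.obj (TopCat.of X)) _⦋k⦌ →₀ ℚ) →ₗ[ℚ] V)

theorem toLin_single (k : ℕ) {V : Type} [AddCommGroup V] [Module ℚ V] (α : C(Dl k, X) → V) (s) :
    toLin X k α (single X k s) = α (eqv X k s) := by
  have := Finsupp.lift_apply V ℚ ((TopCat.toSSet.obj (TopCat.of X)) _⦋k⦌) (fun s => α (eqv X k s))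
   (Finsupp.single s (1 : ℚ))
  rw [Finsupp.sum_single_index (by simp), one_smul] at this
  exact this

theorem lin_ext (k : ℕ) {V : Type} [AddCommGroup V] [Module ℚ V]
    {f g : (singularChainComplex X).X k →ₗ[ℚ] V} (h : ∀ s, f (single X k s) = g (single X k s)) :
    f = g := by
  have : ∀ (f g : ((TopCat.toSSet.obj (TopCat.of X)) _⦋k⦌ →₀ ℚ) →ₗ[ℚ] V),
      (∀ s, f (Finsupp.single s 1) = g (Finsupp.single s 1)) → f = g := by
    intro f g h
    apply Finsupp.lhom_ext'
    intro s
    apply LinearMap.ext_ring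
    exact h s
  exact this f g h

def chainOf (k : ℕ) (z : C(Dl k, X) →₀ ℚ) : (singularChainComplex X).X k :=
  z.sum (fun σ q => q • single X k ((eqv X k).symm σ))

def src {X : Type} [TopologicalSpace X] (σ : C(Dl 1, X)) : X := σ (stdSimplex.vertex 0)
def tgt {X : Type} [TopologicalSpace X] (σ : C(Dl 1, X)) : X := σ (stdSimplex.vertex 1)

def const0 {X : Type} [TopologicalSpace X] (x : X) : C(Dl 0, X) := ContinuousMap.const _ x

theorem dface0 {X : Type} [TopologicalSpace X] (σ : C(Dl 1, X)) : dface 0 σ = const0 (tgt σ) := by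
  ext p
  have : p = stdSimplex.vertex 0 := Subsingleton.elim _ _
  subst this
  simp only [dface, const0, tgt, ContinuousMap.comp_apply, ContinuousMap.coe_mk,
    stdSimplex.map_vertex, ContinuousMap.const_apply]
  rfl

theorem dface1 {X : Type} [TopologicalSpace X] (σ : C(Dl 1, X)) : dface 1 σ = const0 (src σ) := by
  ext p
  have : p = stdSimplex.vertex 0 := Subsingleton.elim _ _
  subst this
  simp only [dface, const0, src, ContinuousMap.comp_apply, ContinuousMap.coe_mk,
    stdSimplex.map_vertex, ContinuousMap.const_apply]
  rfl

def pt (x : X) : (singularChainComplex X).X 0 := single X 0 ((eqv X 0).symm (const0 x))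

theorem d_one (σ : C(Dl 1, X)) :
    ((singularChainComplex X).d 1 0).hom (single X 1 ((eqv X 1).symm σ)) =
      pt X (tgt σ) - pt X (src σ) := by
  rw [d_single, Fin.sum_univ_two]
  have h0 : (TopCat.toSSet.obj (TopCat.of X)).δ 0 ((eqv X 1).symm σ) =
      (eqv X 0).symm (const0 (tgt σ)) := by
    rw [← dface0, Equiv.eq_symm_apply, eqv_δ, Equiv.apply_symm_apply]
  have h1 : (TopCat.toSSet.obj (TopCat.of X)).δ 1 ((eqv X 1).symm σ) =
      (eqv X 0).symm (const0 (src σ)) := by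
    rw [← dface1, Equiv.eq_symm_apply, eqv_δ, Equiv.apply_symm_apply]
  rw [h0, h1]
  simp [pt, sub_eq_add_neg]

theorem d_chainOf (z : C(Dl 1, X) →₀ ℚ) :
    ((singularChainComplex X).d 1 0).hom (chainOf X 1 z) =
     (z.mapDomain tgt).sum (fun x q => q • pt X x) - (z.mapDomain src).sum (fun x q => q • pt X x)
      := by
  rw [Finsupp.sum_mapDomain_index (by simp) (by intros; rw [add_smul]),
    Finsupp.sum_mapDomain_index (by simp) (by intros; rw [add_smul]), chainOf, map_finsuppSum,
    ← Finsupp.sum_sub]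
  apply Finsupp.sum_congr
  intro σ _
  rw [map_smul, d_one, smul_sub]

theorem toLin_chainOf (k : ℕ) {V : Type} [AddCommGroup V] [Module ℚ V] (α : C(Dl k, X) → V)
    (z : C(Dl k, X) →₀ ℚ) : toLin X k α (chainOf X k z) = z.sum (fun σ q => q • α σ) := by
  rw [chainOf, map_finsuppSum]
  apply Finsupp.sum_congr
  intro σ _
  rw [map_smul, toLin_single, Equiv.apply_symm_apply]

theorem chainOf_surj' (k : ℕ) (c : (TopCat.toSSet.obj (TopCat.of X)) _⦋k⦌ →₀ ℚ) :
    chainOf X k (Finsupp.mapDomain (eqv X k) c) = c.sum (fun s q => q • single X k s) := by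
  rw [chainOf, Finsupp.sum_mapDomain_index (by simp) (by intros; rw [add_smul])]
  apply Finsupp.sum_congr
  intro s _
  rw [Equiv.symm_apply_apply]

theorem chainOf_surj (k : ℕ) (c : (singularChainComplex X).X k) : ∃ z, chainOf X k z = c := by
  have key : ∀ c : (TopCat.toSSet.obj (TopCat.of X)) _⦋k⦌ →₀ ℚ,
    c.sum (fun s q => q • (Finsupp.single s (1:ℚ))) = c := by
    intro c
    conv_rhs => rw [← Finsupp.sum_single c]
    apply Finsupp.sum_congr
    intro s _
    rw [Finsupp.smul_single]; simp
  exact ⟨_, (chainOf_surj' X k c).trans (key c)⟩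

theorem cycle_iff (z : C(Dl 1, X) →₀ ℚ) :
    ((singularChainComplex X).d 1 0).hom (chainOf X 1 z) = 0 ↔ z.mapDomain tgt = z.mapDomain src := by
  constructor
  · intro h
    rw [d_chainOf, sub_eq_zero] at h
    have inj : ∀ w : X →₀ ℚ, toLin X 0 (fun c : C(Dl 0, X) => Finsupp.single (c (stdSimplex.vertex 0)) (1:ℚ))
        (w.sum (fun x q => q • pt X x)) = w := by
      intro w
      rw [map_finsuppSum]
      conv_rhs => rw [← Finsupp.sum_single w]
      apply Finsupp.sum_congr
      intro x _
      rw [map_smul, pt, toLin_single, Equiv.apply_symm_apply]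
      simp [const0]
    rw [← inj (z.mapDomain tgt), h, inj]
  · intro h
    rw [d_chainOf, h, sub_self]

def Tri {X V : Type} [TopologicalSpace X] [AddCommGroup V] (α : C(Dl 1, X) → V) : Prop :=
  ∀ τ : C(Dl 2, X), α (dface 0 τ) + α (dface 2 τ) = α (dface 1 τ)

theorem d_comp_toLin {V : Type} [AddCommGroup V] [Module ℚ V] (α : C(Dl 1, X) → V) (hα : Tri α) :
    (toLin X 1 α) ∘ₗ ((singularChainComplex X).d 2 1).hom = 0 := by
  apply lin_ext
  intro s
  rw [LinearMap.comp_apply, d_single, Fin.sum_univ_three]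
  have := hα (eqv X 2 s)
  simp only [map_add, map_zsmul, toLin_single, eqv_δ]
  simp [← this]

theorem bridge1 {V : Type} [AddCommGroup V] [Module ℚ V] (α : C(Dl 1, X) → V) (hα : Tri α)
    (hfin : FiniteBetti X 1)
    (hs : ∀ v : V, ∃ z : C(Dl 1, X) →₀ ℚ, z.mapDomain tgt = z.mapDomain src ∧
      z.sum (fun σ q => q • α σ) = v) :
    Module.finrank ℚ V ≤ bettiNumber X 1 := by
  let K := singularChainComplex X
  let f : K.X 1 ⟶ ModuleCat.of ℚ V := ModuleCat.ofHom (toLin X 1 α)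
  have hf : K.d 2 1 ≫ f = 0 := by
    ext1
    exact d_comp_toLin X α hα
  let φ : K.homology 1 ⟶ ModuleCat.of ℚ V := K.homologyι 1 ≫ K.descOpcycles f 2 (by simp) hf
  have hφ : K.homologyπ 1 ≫ φ = K.iCycles 1 ≫ f := by
    simp [φ]
  have surj : Function.Surjective φ.hom := by
    intro v
    obtain ⟨z, hz, hv⟩ := hs v
    have hz' := (cycle_iff X z).2 hz
    let c := K.cyclesMk (chainOf X 1 z) 0 (by simp) hz'
    have hc : (K.iCycles 1).hom c = chainOf X 1 z := K.i_cyclesMk _ 0 (by simp) hz'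
    refine ⟨(K.homologyπ 1).hom c, ?_⟩
    have := congrArg (fun g => g.hom c) hφ
    simp only [ModuleCat.hom_comp, LinearMap.comp_apply] at this
    rw [this, hc]
    exact (toLin_chainOf X 1 α z).trans hv
  have : Module.Finite ℚ (singularHomology X 1) := hfin
  exact LinearMap.finrank_le_finrank_of_surjective (f := φ.hom) surj

theorem alg2 (K : ChainComplex (ModuleCat ℚ) ℕ) : ∃ ρ : K.X 1 →ₗ[ℚ] K.homology 1,
    (∀ y, ρ ((K.d 2 1).hom y) = 0) ∧ ∀ v, ∃ c : K.X 1, (K.d 1 0).hom c = 0 ∧ ρ c = v := by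
  have hinj : Function.Injective (K.homologyι 1).hom := by
    rw [← ModuleCat.mono_iff_injective]; infer_instance
  obtain ⟨ρ, hρ⟩ := LinearMap.exists_leftInverse_of_injective (K.homologyι 1).hom
    (LinearMap.ker_eq_bot.2 hinj)
  have hπ : Function.Surjective (K.homologyπ 1).hom := by
    rw [← ModuleCat.epi_iff_surjective]; infer_instance
  refine ⟨ρ ∘ₗ (K.pOpcycles 1).hom, ?_, ?_⟩
  · intro y
    have := congrArg (fun g => g.hom y) (K.d_pOpcycles 2 1)
    have h2 : (K.pOpcycles 1).hom ((K.d 2 1).hom y) = 0 := this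
    rw [LinearMap.comp_apply, h2, map_zero]
  · intro v
    obtain ⟨c, rfl⟩ := hπ v
    refine ⟨(K.iCycles 1).hom c, ?_, ?_⟩
    · exact congrArg (fun g => g.hom c) (K.iCycles_d 1 0)
    · have e : (K.homologyι 1).hom ((K.homologyπ 1).hom c) =
         (K.pOpcycles 1).hom ((K.iCycles 1).hom c) := congrArg (fun g => g.hom c) (K.homology_π_ι 1)
      rw [LinearMap.comp_apply, ← e]
      exact congrArg (fun g => g ((K.homologyπ 1).hom c)) hρ

theorem bridge2 : ∃ α : C(Dl 1, X) → (singularHomology X 1 : Type), Tri α ∧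
    ∀ v, ∃ z : C(Dl 1, X) →₀ ℚ, z.mapDomain tgt = z.mapDomain src ∧
      z.sum (fun σ q => q • α σ) = v := by
  have h : ∃ ρ : (singularChainComplex X).X 1 →ₗ[ℚ] (singularHomology X 1),
    (∀ y, ρ (((singularChainComplex X).d 2 1).hom y) = 0) ∧
    ∀ v, ∃ c : (singularChainComplex X).X 1, ((singularChainComplex X).d 1 0).hom c = 0 ∧ ρ c = v :=
    alg2 _
  obtain ⟨ρ, h1, h2⟩ := h
  let α : C(Dl 1, X) → (singularHomology X 1 : Type) := fun σ => ρ (single X 1 ((eqv X 1).symm σ))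
  have hlin : toLin X 1 α = ρ := by
    apply lin_ext
    intro s
    rw [toLin_single]
    simp only [α, Equiv.symm_apply_apply]
  refine ⟨α, ?_, ?_⟩
  · intro τ
    have this := h1 (single X 2 ((eqv X 2).symm τ))
    rw [← hlin, d_single, Fin.sum_univ_three] at this
    simp only [map_add, map_zsmul, toLin_single, eqv_δ, Equiv.apply_symm_apply] at this
    simp only [Fin.val_zero, pow_zero, one_smul, Fin.val_one, pow_one, neg_smul, Fin.val_two,
      even_two, Even.neg_pow, one_pow] at this
    rw [← sub_eq_zero, ← this]; abel
  · intro v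
    obtain ⟨c, hc, hv⟩ := h2 v
    obtain ⟨z, hz⟩ := chainOf_surj X 1 c
    refine ⟨z, ?_, ?_⟩
    · rw [← cycle_iff, hz, hc]
    · rw [← toLin_chainOf, hz, hlin, hv]

end AS
end
end

section
open Filter Set Topology
noncomputable section
namespace AS

theorem cc (k : ℕ) (i : Fin (k+1)) : Continuous (fun p : Dl k => p.1 i) :=
  (continuous_apply i).comp continuous_subtype_val

section seg
set_option linter.unusedSimpArgs false
variable {X V F : Type} [TopologicalSpace X] [AddCommGroup V]
  [AddCommGroup F] [Module ℝ F] [TopologicalSpace F] [ContinuousAdd F] [ContinuousSMul ℝ F]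

def seg (f : C(F, X)) (a b : F) : C(Dl 1, X) :=
  f.comp ⟨fun p => p.1 0 • a + p.1 1 • b,
    ((cc 1 0).smul continuous_const).add ((cc 1 1).smul continuous_const)⟩

def tri (f : C(F, X)) (a b c : F) : C(Dl 2, X) :=
  f.comp ⟨fun p => p.1 0 • a + p.1 1 • b + p.1 2 • c,
    (((cc 2 0).smul continuous_const).add ((cc 2 1).smul continuous_const)).add
      ((cc 2 2).smul continuous_const)⟩

theorem vx (k : ℕ) (i j : Fin (k+1)) : (stdSimplex.vertex i : Dl k).1 j = if j = i then 1 else 0 := by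
  change (Pi.single i (1:ℝ) : Fin (k+1) → ℝ) j = _
  rw [Pi.single_apply]

theorem map_val (k : ℕ) (i : Fin (k+2)) (p : Dl k) (j : Fin (k + 2)) :
    (stdSimplex.map i.succAbove p).1 j = ∑ l, if i.succAbove l = j then p.1 l else 0 := by
  change (FunOnFinite.linearMap ℝ ℝ i.succAbove p.1) j = _
  rw [FunOnFinite.linearMap_apply_apply, Finset.sum_filter]

theorem src_seg (f : C(F, X)) (a b : F) : src (seg f a b) = f a := by
  simp [src, seg, vx]

theorem tgt_seg (f : C(F, X)) (a b : F) : tgt (seg f a b) = f b := by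
  simp [tgt, seg, vx]

theorem seg_tri {α : C(Dl 1, X) → V} (hα : Tri α) (f : C(F, X)) (a b c : F) :
    α (seg f a b) + α (seg f b c) = α (seg f a c) := by
  have h := hα (tri f a b c)
  have h0 : dface 0 (tri f a b c) = seg f b c := by
    ext p
    have e1 : (0 : Fin 3).succAbove 0 = 1 := rfl
    have e2 : (0 : Fin 3).succAbove 1 = 2 := rfl
    simp only [dface, tri, seg, ContinuousMap.comp_apply, ContinuousMap.coe_mk, map_val, Fin.sum_univ_two, e1, e2]
    simp
  have h1 : dface 1 (tri f a b c) = seg f a c := by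
    ext p
    have e1 : (1 : Fin 3).succAbove 0 = 0 := rfl
    have e2 : (1 : Fin 3).succAbove 1 = 2 := rfl
    simp only [dface, tri, seg, ContinuousMap.comp_apply, ContinuousMap.coe_mk, map_val, Fin.sum_univ_two, e1, e2]
    simp
  have h2 : dface 2 (tri f a b c) = seg f a b := by
    ext p
    have e1 : (2 : Fin 3).succAbove 0 = 0 := rfl
    have e2 : (2 : Fin 3).succAbove 1 = 1 := rfl
    simp only [dface, tri, seg, ContinuousMap.comp_apply, ContinuousMap.coe_mk, map_val, Fin.sum_univ_two, e1, e2]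
    simp [show (2:Fin 3).succAbove (1 : Fin 2) = 1 from rfl]
  rw [h0, h1, h2] at h
  rw [← h, add_comm]

theorem const_zero {α : C(Dl 1, X) → V} (hα : Tri α) (x : X) : α (ContinuousMap.const _ x) = 0 := by
  have h := hα (ContinuousMap.const _ x)
  have e : ∀ i, dface i (ContinuousMap.const (Dl 2) x) = ContinuousMap.const (Dl 1) x := by
    intro i; rfl
  rw [e, e, e] at h
  simpa using h

end seg

def cl (s : ℝ) : ℝ := max 0 (min s 1)

theorem cl_mem (s : ℝ) : cl s ∈ Icc (0:ℝ) 1 := ⟨le_max_left _ _, max_le zero_le_one (min_le_right _ _)⟩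
theorem cl_id {s : ℝ} (h : s ∈ Icc (0:ℝ) 1) : cl s = s := by
  rw [cl, min_eq_left h.2, max_eq_right h.1]
theorem cl_cont : Continuous cl := by unfold cl; fun_prop

def pt1 (s : ℝ) : Dl 1 := ⟨![1 - cl s, cl s], by
  intro i; fin_cases i
  · simpa using (cl_mem s).2
  · simpa using (cl_mem s).1, by simp [Fin.sum_univ_two]⟩

theorem pt1_cont : Continuous pt1 := by
  unfold pt1
  refine Continuous.subtype_mk ?_ _
  refine continuous_pi ?_
  intro i; fin_cases i
  · change Continuous (fun s => 1 - cl s)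
    exact continuous_const.sub cl_cont
  · simpa using cl_cont

theorem mem01 (p : Dl 1) : p.1 1 ∈ Icc (0:ℝ) 1 ∧ p.1 0 = 1 - p.1 1 := by
  have h := p.2.2
  rw [Fin.sum_univ_two] at h
  have h0 := p.2.1 0
  have h1 := p.2.1 1
  exact ⟨⟨h1, by linarith⟩, by linarith⟩

theorem pt1_of (p : Dl 1) : pt1 (p.1 1) = p := by
  apply Subtype.ext
  funext i
  have := mem01 p
  unfold pt1
  fin_cases i
  · simp [cl_id this.1, this.2]
  · simp [cl_id this.1]

theorem pt1_zero : pt1 0 = stdSimplex.vertex 0 := by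
  rw [← pt1_of (stdSimplex.vertex 0), vx]; simp

theorem pt1_one : pt1 1 = stdSimplex.vertex 1 := by
  rw [← pt1_of (stdSimplex.vertex 1), vx]; simp

section hat
variable {X V : Type} [TopologicalSpace X] [AddCommGroup V]

def hat (σ : C(Dl 1, X)) : C(ℝ, X) := σ.comp ⟨pt1, pt1_cont⟩

theorem hat_zero (σ : C(Dl 1, X)) : hat σ 0 = src σ := by simp [hat, src, pt1_zero]
theorem hat_one (σ : C(Dl 1, X)) : hat σ 1 = tgt σ := by simp [hat, tgt, pt1_one]
theorem hat_ap (σ : C(Dl 1, X)) (s : ℝ) : hat σ s = σ (pt1 s) := rfl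

theorem seg_hat (σ : C(Dl 1, X)) : seg (hat σ) (0:ℝ) 1 = σ := by
  ext p
  simp only [seg, hat, ContinuousMap.comp_apply, ContinuousMap.coe_mk]
  simp [pt1_of]

theorem cone {F : Type} [NormedAddCommGroup F] [NormedSpace ℝ F] {C : Set F} (hC : Convex ℝ C)
    {c0 : F} (hc0 : c0 ∈ C) {T : Set X} (γ : F → X) (hγ : ContinuousOn γ C) (l : X → F)
    (hl : ContinuousOn l T) (hlC : MapsTo l T C) (hγl : ∀ x ∈ T, γ (l x) = x)
    {α : C(Dl 1, X) → V} (hα : Tri α) :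
    ∃ g : X → V, ∀ σ : C(Dl 1, X), (∀ p, σ p ∈ T) → α σ = g (tgt σ) - g (src σ) := by
  classical
  have hmem : ∀ w ∈ C, ∀ s : ℝ, c0 + cl s • (w - c0) ∈ C := fun w hw s =>
    hC.add_smul_sub_mem hc0 hw (cl_mem s)
  have hr : ∀ w ∈ C, Continuous (fun s : ℝ => γ (c0 + cl s • (w - c0))) := by
    intro w hw
    rw [← continuousOn_univ]
    refine hγ.comp (Continuous.continuousOn ?_) (fun s _ => hmem w hw s)
    have := cl_cont
    fun_prop
  let ray : (w : F) → w ∈ C → C(ℝ, X) := fun w hw => ⟨_, hr w hw⟩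
  let g : X → V := fun x => if h : x ∈ T then α (seg (ray (l x) (hlC h)) (0:ℝ) 1) else 0
  refine ⟨g, ?_⟩
  intro σ hσ
  have hσ' : ∀ u, hat σ u ∈ T := fun u => hσ _
  have hlσ : Continuous (fun u : ℝ => l (hat σ u)) := by
    rw [← continuousOn_univ]
    exact hl.comp (hat σ).continuous.continuousOn (fun u _ => hσ' u)
  have hfc : Continuous (fun q : ℝ × ℝ => γ (c0 + cl q.1 • (l (hat σ q.2) - c0))) := by
    rw [← continuousOn_univ]
    refine hγ.comp (Continuous.continuousOn ?_) (fun q _ => hmem _ (hlC (hσ' q.2)) q.1)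
    have := cl_cont
    have h2 : Continuous (fun q : ℝ × ℝ => l (hat σ q.2)) := hlσ.comp continuous_snd
    exact continuous_const.add ((this.comp continuous_fst).smul (h2.sub continuous_const))
  let f : C(ℝ × ℝ, X) := ⟨_, hfc⟩
  have e1 : seg f (1, 0) (1, 1) = σ := by
    conv_rhs => rw [← seg_hat σ]
    ext p
    have h1 : p.1 0 + p.1 1 = 1 := by rw [(mem01 p).2]; ring
    simp only [seg, f, ContinuousMap.comp_apply, ContinuousMap.coe_mk]
    simp only [Prod.smul_mk, Prod.mk_add_mk, smul_eq_mul, mul_one, mul_zero, h1, zero_add]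
    rw [cl_id (by simp), one_smul, add_sub_cancel, hγl _ (hσ' _)]
  have e2 : α (seg f (0, 0) (0, 1)) = 0 := by
    rw [← const_zero hα (γ c0)]
    congr 1
    ext p
    simp only [seg, f, ContinuousMap.comp_apply, ContinuousMap.coe_mk]
    simp only [Prod.smul_mk, Prod.mk_add_mk, smul_eq_mul, mul_one, mul_zero, zero_add]
    rw [cl_id (by simp), zero_smul, add_zero]; rfl
  have e3 : ∀ u : ℝ, α (seg f (0, u) (1, u)) = g (hat σ u) := by
    intro u
    simp only [g, dif_pos (hσ' u)]
    congr 1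
    ext p
    have h1 : p.1 0 * u + p.1 1 * u = u := by rw [(mem01 p).2]; ring
    simp only [seg, f, ray, ContinuousMap.comp_apply, ContinuousMap.coe_mk]
    simp only [Prod.smul_mk, Prod.mk_add_mk, smul_eq_mul, mul_one, mul_zero, zero_add, h1]
  have t1 := seg_tri hα f (0, 0) (1, 0) (1, 1)
  have t2 := seg_tri hα f (0, 0) (0, 1) (1, 1)
  rw [e1, e3, hat_zero] at t1
  rw [e2, e3, hat_one, zero_add] at t2
  rw [t2, ← t1]; abel

theorem potential {β : C(Dl 1, X) → V} [Module ℚ V]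
    (h : ∀ z : C(Dl 1, X) →₀ ℚ, z.mapDomain tgt = z.mapDomain src → z.sum (fun σ q => q • β σ) = 0) :
    ∃ G : X → V, ∀ σ, β σ = G (tgt σ) - G (src σ) := by
  have hp : ∀ x y : X, Joined x y → ∃ σ : C(Dl 1, X), src σ = x ∧ tgt σ = y := by
    intro x y ⟨γ⟩
    refine ⟨γ.toContinuousMap.comp ⟨fun p => ⟨p.1 1, (mem01 p).1⟩,
      Continuous.subtype_mk (cc 1 1) _⟩, ?_, ?_⟩
    · simp [src, vx]
    · simp [tgt, vx]
  have hp' : ∀ σ : C(Dl 1, X), Joined (src σ) (tgt σ) := by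
    intro σ
    refine ⟨⟨⟨fun s => hat σ s.1, by fun_prop⟩, ?_, ?_⟩⟩
    · simp [hat_zero]
    · simp [hat_one]
  let base : X → X := fun x => (Quotient.mk (pathSetoid X) x).out
  have hb : ∀ x, Joined (base x) x := fun x => Quotient.mk_out (s := pathSetoid X) x
  choose P hP1 hP2 using fun x => hp _ _ (hb x)
  refine ⟨fun x => β (P x), ?_⟩
  intro σ
  have hbase : base (src σ) = base (tgt σ) := by
    have : Quotient.mk (pathSetoid X) (src σ) = Quotient.mk (pathSetoid X) (tgt σ) :=
      Quotient.sound (hp' σ)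
    simp only [base, this]
  have := h (Finsupp.single (P (src σ)) 1 + Finsupp.single σ 1 - Finsupp.single (P (tgt σ)) 1) (by
    rw [sub_eq_add_neg, ← Finsupp.single_neg]
    simp only [Finsupp.mapDomain_add, Finsupp.mapDomain_single, hP1, hP2, hbase]
    simp only [Finsupp.single_neg]; abel)
  rw [Finsupp.sum_sub_index (by intros; rw [sub_smul]),
    Finsupp.sum_add_index' (by simp) (by intros; rw [add_smul])] at this
  simp only [Finsupp.sum_single_index, zero_smul, one_smul] at this
  rw [sub_eq_zero] at this
  simp only
  rw [← this]; abel

end hat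

section int
variable {T V : Type} [TopologicalSpace T] [AddCommGroup V] {X : Set T}

def Int (A : T → T → V) (σ : C(Dl 1, X)) (v : V) : Prop :=
  ∃ h : ℝ → V, IsPrim (fun a b => A (hat σ a) (hat σ b)) h univ ∧ v = h 1 - h 0

theorem Int_exists {A : T → T → V} (hA : IsCoc A X) (σ : C(Dl 1, X)) : ∃ v, Int A σ v := by
  have h1 : IsCoc (fun a b => A (hat σ a) (hat σ b)) univ :=
    hA.pull (f := fun a => (hat σ a : T)) (by fun_prop) (fun a _ => (hat σ a).2)
  obtain ⟨g, hg⟩ := h1.exact_real isOpen_univ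
  exact ⟨_, g, hg, rfl⟩

theorem Int_unique {A : T → T → V} {σ : C(Dl 1, X)} {v w : V} (hv : Int A σ v) (hw : Int A σ w) :
    v = w := by
  obtain ⟨g, hg, rfl⟩ := hv
  obtain ⟨h, hh, rfl⟩ := hw
  exact hg.unique hh isPreconnected_univ trivial trivial

theorem Int_congr {A B : T → T → V} {σ : C(Dl 1, X)} {v : V} {S : Set T} (hv : Int A σ v)
    (hσ : ∀ p, (σ p : T) ∈ S) (h : LocEq B A S) : Int B σ v := by
  obtain ⟨g, hg, rfl⟩ := hv
  refine ⟨g, hg.congr ?_, rfl⟩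
  intro s _
  obtain ⟨U, hU, h'⟩ := h (hat σ s) (hσ _)
  have hc : ContinuousWithinAt (fun a => (hat σ a : T)) univ s := by
    apply Continuous.continuousWithinAt; fun_prop
  have : Tendsto (fun a => (hat σ a : T)) (𝓝[univ] s) (𝓝[S] (hat σ s : T)) :=
    tendsto_nhdsWithin_iff.2 ⟨hc, Eventually.of_forall fun a => hσ _⟩
  exact ⟨_, this hU, fun a ha b hb => h' _ ha _ hb⟩

theorem Int_prim {A : T → T → V} {σ : C(Dl 1, X)} {v : V} {S : Set T} {G : T → V}
    (hG : IsPrim A G S) (hv : Int A σ v) (hσ : ∀ p, (σ p : T) ∈ S) :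
    v = G (tgt σ : X) - G (src σ : X) := by
  obtain ⟨g, hg, rfl⟩ := hv
  have := hG.pull (f := fun a => (hat σ a : T)) (S' := univ) (by fun_prop) (fun a _ => hσ _)
  rw [hg.unique this isPreconnected_univ (x := 0) (y := 1) trivial trivial, hat_zero, hat_one]

theorem Int_strict {A : T → T → V} {σ : C(Dl 1, X)} {v : V} {U : Set T}
    (hv : Int A σ v) (hσ : ∀ p, (σ p : T) ∈ U)
    (h : ∀ a ∈ U, ∀ b ∈ U, ∀ c ∈ U, A a b + A b c = A a c) : v = A (src σ : X) (tgt σ : X) := by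
  have h0 : ((src σ : X) : T) ∈ U := hσ _
  rw [Int_prim (prim_of_strict (Subset.refl U) h h0) hv hσ, strict_self h h0, sub_zero]

theorem Int_map {W : Type} [AddCommGroup W] (f : V →+ W) {A : T → T → V} {σ : C(Dl 1, X)} {v : V}
    (hv : Int A σ v) : Int (fun a b => f (A a b)) σ (f v) := by
  obtain ⟨g, hg, rfl⟩ := hv
  refine ⟨fun x => f (g x), ?_, by simp⟩
  intro s hs
  obtain ⟨U, hU, h'⟩ := hg s hs
  refine ⟨U, hU, fun a ha b hb => ?_⟩
  have := h' a ha b hb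
  simp only at this ⊢
  rw [this, map_sub]

theorem exact_convex_type {F : Type*} [NormedAddCommGroup F] [NormedSpace ℝ F] {C : Set F}
    (hC : Convex ℝ C) (c0 : C) {A : C → C → V} (hA : IsCoc A univ) : ∃ g, IsPrim A g univ := by
  classical
  let r : F → C := fun x => if h : x ∈ C then ⟨x, h⟩ else c0
  have hr : ∀ c : C, r c = c := fun c => by simp [r]
  have hrc : ContinuousOn r C := by
    rw [continuousOn_iff_continuous_domRestrict]
    have : C.domRestrict r = id := by ext c; simp [hr]
    rw [this]; exact continuous_id
  obtain ⟨g, hg⟩ := (hA.pull hrc (mapsTo_univ _ _)).exact_convex hC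
  refine ⟨fun c => g c, ?_⟩
  have := hg.pull (f := fun c : C => (c : F)) (S' := univ) (by fun_prop) (fun c _ => c.2)
  simpa only [hr] using this

theorem Int_tri {A : T → T → V} (hA : IsCoc A X) (τ : C(Dl 2, X)) {u v w : V}
    (hu : Int A (dface 0 τ) u) (hv : Int A (dface 2 τ) v) (hw : Int A (dface 1 τ) w) :
    u + v = w := by
  obtain ⟨g, hg⟩ := exact_convex_type (convex_stdSimplex ℝ (Fin 3)) (stdSimplex.vertex 0 : Dl 2)
    (hA.pull (f := fun p : Dl 2 => (τ p : T)) (S' := univ) (by fun_prop) (fun p _ => (τ p).2))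
  have key : ∀ (i : Fin 3) (u : V), Int A (dface i τ) u →
      u = g (stdSimplex.vertex (i.succAbove 1)) - g (stdSimplex.vertex (i.succAbove 0)) := by
    intro i u hu
    refine Int_unique hu ?_
    have hc : Continuous (fun s => (stdSimplex.map i.succAbove (pt1 s) : Dl 2)) :=
      (stdSimplex.continuous_map _).comp pt1_cont
    have := hg.pull (f := fun s => (stdSimplex.map i.succAbove (pt1 s) : Dl 2)) (S' := univ)
      hc.continuousOn (fun c _ => trivial)
    refine ⟨_, this, ?_⟩
    simp only [pt1_one, pt1_zero, stdSimplex.map_vertex]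
  rw [key _ _ hu, key _ _ hv, key _ _ hw]
  have e1 : (1 : Fin 3).succAbove 0 = 0 := rfl
  have e2 : (1 : Fin 3).succAbove 1 = 2 := rfl
  have e3 : (2 : Fin 3).succAbove 0 = 0 := rfl
  have e4 : (2 : Fin 3).succAbove 1 = 1 := rfl
  have e5 : (0 : Fin 3).succAbove 0 = 1 := rfl
  have e6 : (0 : Fin 3).succAbove 1 = 2 := rfl
  rw [e1, e2, e3, e4, e5, e6]; abel

end int

section build
variable {T V : Type} [PseudoMetricSpace T] [AddCommGroup V] {X : Set T}

theorem coc_of_tri {α : C(Dl 1, X) → V} (hα : Tri α) {S : Set T} {δ0 δ1 : ℝ} (h0 : 0 < δ0)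
    (h1 : 0 < δ1) (hSX : S ⊆ X)
    (H1 : ∀ x ∈ S, ∃ g : T → V, ∀ σ : C(Dl 1, X), (∀ p, (σ p : T) ∈ Metric.ball x (2 * δ0)) →
      α σ = g (tgt σ : X) - g (src σ : X))
    (H2 : ∀ x ∈ S, ∀ a b : X, (a : T) ∈ Metric.ball x δ1 → (b : T) ∈ Metric.ball x δ1 →
      ∃ σ : C(Dl 1, X), src σ = a ∧ tgt σ = b ∧ ∀ p, (σ p : T) ∈ Metric.ball x δ0) :
    ∃ A : T → T → V, IsCoc A S ∧ ∀ σ : C(Dl 1, X), (∀ p, (σ p : T) ∈ S) → Int A σ (α σ) := by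
  classical
  let A : T → T → V := fun a b => if h : ∃ σ : C(Dl 1, X), (src σ : X) = a ∧ (tgt σ : X) = b ∧
    ∀ p, (σ p : T) ∈ Metric.ball a δ0 then α h.choose else 0
  have key : ∀ x ∈ S, ∃ ε > 0, ∃ g : T → V, (∀ a ∈ S ∩ Metric.ball x ε, ∀ b ∈ S ∩ Metric.ball x ε,
      A a b = g b - g a) ∧ (∀ σ : C(Dl 1, X), (∀ p, (σ p : T) ∈ Metric.ball x ε) →
        α σ = g (tgt σ : X) - g (src σ : X)) := by
    intro x hx
    obtain ⟨g, hg⟩ := H1 x hx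
    refine ⟨min δ0 (δ1 / 2), by positivity, g, ?_, ?_⟩
    · rintro a ⟨haS, ha⟩ b ⟨hbS, hb⟩
      rw [Metric.mem_ball, lt_min_iff] at ha hb
      have h : ∃ σ : C(Dl 1, X), (src σ : X) = a ∧ (tgt σ : X) = b ∧ ∀ p, (σ p : T) ∈ Metric.ball a δ0 := by
        obtain ⟨σ, hs, ht, hσ⟩ := H2 a haS ⟨a, hSX haS⟩ ⟨b, hSX hbS⟩ (by simpa using h1) (by
          rw [Metric.mem_ball]
          have := dist_triangle_right b a x
          simp only
          linarith)
        exact ⟨σ, by rw [hs], by rw [ht], hσ⟩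
      simp only [A, dif_pos h]
      rw [hg h.choose ?_, h.choose_spec.1, h.choose_spec.2.1]
      intro p
      have := h.choose_spec.2.2 p
      rw [Metric.mem_ball] at this ⊢
      have := dist_triangle (h.choose p : T) a x
      linarith
    · intro σ hσ
      apply hg
      intro p
      refine Metric.ball_subset_ball ?_ (hσ p)
      refine (min_le_left _ _).trans (by linarith)
  refine ⟨A, ?_, ?_⟩
  · intro x hx
    obtain ⟨ε, hε, g, hg, -⟩ := key x hx
    refine ⟨S ∩ Metric.ball x ε, inter_mem self_mem_nhdsWithin
      (mem_nhdsWithin_of_mem_nhds (Metric.ball_mem_nhds x hε)), ?_⟩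
    intro a ha b hb c hc
    rw [hg a ha b hb, hg b hb c hc, hg a ha c hc]; abel
  · intro σ hσ
    refine ⟨fun s => α (seg (hat σ) (0:ℝ) s), ?_, ?_⟩
    · intro s _
      obtain ⟨ε, hε, g, hg, hg'⟩ := key (hat σ s) (hσ _)
      have hc : Continuous (fun a => (hat σ a : T)) := by fun_prop
      obtain ⟨η, hη, hηε⟩ := Metric.continuous_iff.1 hc s ε hε
      refine ⟨Metric.ball s η, mem_nhdsWithin_of_mem_nhds (Metric.ball_mem_nhds s hη), ?_⟩
      intro a ha b hb
      have e := seg_tri hα (hat σ) (0:ℝ) a b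
      simp only
      rw [← e, add_sub_cancel_left]
      rw [hg' (seg (hat σ) a b) ?_, src_seg, tgt_seg]
      · exact hg _ ⟨hσ _, hηε a ha⟩ _ ⟨hσ _, hηε b hb⟩
      · intro p
        apply hηε
        exact (convex_ball s η) ha hb (p.2.1 0) (p.2.1 1) (by rw [(mem01 p).2]; ring)
    · simp only
      have e := seg_tri hα (hat σ) (0:ℝ) 0 1
      have e0 := seg_tri hα (hat σ) (0:ℝ) 0 0
      have : α (seg (hat σ) (0:ℝ) 0) = 0 := by simpa using e0
      rw [this, sub_zero, seg_hat]

end build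
end AS
end
end

section
open Filter Set Topology
noncomputable section
namespace AS

theorem cont_fderiv {E F : Type} [NormedAddCommGroup E] [NormedSpace ℂ E] [NormedAddCommGroup F]
    [NormedSpace ℂ F] {f : E → F} {U : Set E} (hU : IsOpen U) (hf : DifferentiableOn ℂ f U)
    {x : E} (hx : x ∈ U) : ContinuousAt (fderiv ℂ f) x := by
  rw [Metric.continuousAt_iff]
  intro ε hε
  have hd : ∀ z ∈ U, DifferentiableAt ℂ f z := fun z hz => hf.differentiableAt (hU.mem_nhds hz)
  have h1 := ((hd x hx).hasFDerivAt.isLittleO).def (show 0 < ε / 6 by positivity)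
  obtain ⟨ρ, hρ, hρ'⟩ := Metric.eventually_nhds_iff_ball.1 (h1.and (hU.mem_nhds hx))
  refine ⟨ρ / 2, by positivity, ?_⟩
  intro z hz
  rw [dist_eq_norm]
  refine lt_of_le_of_lt (ContinuousLinearMap.opNorm_le_bound _ (show 0 ≤ ε / 2 by positivity) ?_)
    (half_lt_self hε)
  intro v
  by_cases hv : v = 0
  · simp [hv]
  have hv' : 0 < ‖v‖ := norm_pos_iff.2 hv
  set R := ρ / (3 * ‖v‖) with hR
  have hRp : 0 < R := by positivity
  have hin : ∀ ζ : ℂ, ‖ζ‖ ≤ R → z + ζ • v ∈ Metric.ball x ρ := by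
    intro ζ hζ
    rw [Metric.mem_ball, dist_eq_norm]
    rw [dist_eq_norm] at hz
    have e1 : ‖ζ • v‖ ≤ ρ / 3 := by
      rw [norm_smul]
      calc ‖ζ‖ * ‖v‖ ≤ R * ‖v‖ := by gcongr
        _ = ρ / 3 := by rw [hR]; field_simp
    calc ‖z + ζ • v - x‖ = ‖(z - x) + ζ • v‖ := by congr 1; abel
      _ ≤ ‖z - x‖ + ‖ζ • v‖ := norm_add_le _ _
      _ < ρ := by linarith
  let φ : ℂ → F := fun ζ => f (z + ζ • v) - f x - fderiv ℂ f x (z + ζ • v - x)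
  have hline : ∀ ζ : ℂ, HasDerivAt (fun ζ : ℂ => z + ζ • v) v ζ := by
    intro ζ
    simpa using ((hasDerivAt_id ζ).smul_const v).const_add z
  have hφd : ∀ ζ : ℂ, ‖ζ‖ ≤ R → HasDerivAt φ (fderiv ℂ f (z + ζ • v) v - fderiv ℂ f x v) ζ := by
    intro ζ hζ
    have h1 := ((hd _ (hρ' _ (hin ζ hζ)).2).hasFDerivAt).comp_hasDerivAt ζ (hline ζ)
    have h2 := ((fderiv ℂ f x).hasFDerivAt (x := z + ζ • v - x)).comp_hasDerivAt ζ ((hline ζ).sub_const x)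
    exact (h1.sub_const (f x)).sub h2
  have hdc : DiffContOnCl ℂ φ (Metric.ball 0 R) := by
    apply DifferentiableOn.diffContOnCl
    intro ζ hζ
    have := Metric.closure_ball_subset_closedBall hζ
    exact (hφd ζ (by simpa using this)).differentiableAt.differentiableWithinAt
  have hbd : ∀ ζ ∈ Metric.sphere (0:ℂ) R, ‖φ ζ‖ ≤ ε / 6 * ρ := by
    intro ζ hζ
    have hb := hin ζ (by simpa using (Metric.sphere_subset_closedBall hζ))
    refine ((hρ' _ hb).1).trans ?_
    rw [Metric.mem_ball, dist_eq_norm] at hb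
    gcongr
  have := Complex.norm_deriv_le_of_forall_mem_sphere_norm_le hRp hdc hbd
  rw [(hφd 0 (by simpa using hRp.le)).deriv] at this
  simp only [zero_smul, add_zero] at this
  rw [ContinuousLinearMap.sub_apply]
  refine this.trans ?_
  rw [hR]
  have : ε / 6 * ρ / (ρ / (3 * ‖v‖)) = ε / 2 * ‖v‖ := by field_simp; norm_num
  rw [this]

theorem inv_thm {E F : Type} [NormedAddCommGroup E] [NormedSpace ℂ E] [CompleteSpace E]
    [NormedAddCommGroup F]
    [NormedSpace ℂ F] {f : E → F} {U : Set E} (hU : IsOpen U) (hf : DifferentiableOn ℂ f U)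
    {x : E} (hx : x ∈ U) (e : E ≃L[ℂ] F) (he : fderiv ℂ f x = e) :
    ∃ Φ : OpenPartialHomeomorph E F, (Φ : E → F) = f ∧ x ∈ Φ.source ∧ Φ.source ⊆ U ∧
      DifferentiableOn ℂ Φ.symm Φ.target := by
  have hc := cont_fderiv hU hf hx
  have hd : ∀ z ∈ U, HasFDerivAt f (fderiv ℂ f z) z :=
    fun z hz => (hf.differentiableAt (hU.mem_nhds hz)).hasFDerivAt
  have hs : HasStrictFDerivAt f (fderiv ℂ f x) x :=
    hasStrictFDerivAt_of_hasFDerivAt_of_continuousAt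
      (by filter_upwards [hU.mem_nhds hx] with z hz using hd z hz) hc
  rw [he] at hs
  have hn : range ((↑) : (E ≃L[ℂ] F) → E →L[ℂ] F) ∈ 𝓝 (fderiv ℂ f x) := by
    rw [he]; exact e.nhds
  obtain ⟨W, hWsub, hWo, hxW⟩ := mem_nhds_iff.1 (inter_mem (hc hn) (hU.mem_nhds hx))
  let Φ := (hs.toOpenPartialHomeomorph f).restrOpen W hWo
  have hΦ : (Φ : E → F) = f := hs.toOpenPartialHomeomorph_coe
  have hsrc : Φ.source ⊆ W := fun z hz => hz.2
  refine ⟨Φ, hΦ, ⟨hs.mem_toOpenPartialHomeomorph_source, hxW⟩, fun z hz => (hWsub (hsrc hz)).2, ?_⟩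
  intro y hy
  have hz := Φ.map_target hy
  obtain ⟨e', he'⟩ := (hWsub (hsrc hz)).1
  have := Φ.hasFDerivAt_symm (f' := e') hy (by
    rw [hΦ, he']; exact hd _ (hWsub (hsrc hz)).2)
  exact this.differentiableAt.differentiableWithinAt

theorem exists_lin {N k n : ℕ} (hN : N = k + n + 1) (a : (Fin N → ℂ) →L[ℂ] (Fin k → ℂ))
    (b : (Fin N → ℂ) →L[ℂ] (Fin n → ℂ)) (ha : Function.Surjective a)
    (hb : Submodule.map b.toLinearMap (LinearMap.ker a.toLinearMap) = ⊤) :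
    ∃ (L : (Fin N → ℂ) →L[ℂ] ℂ) (e : (Fin N → ℂ) ≃L[ℂ] (Fin k → ℂ) × (Fin n → ℂ) × ℂ),
      (e : (Fin N → ℂ) →L[ℂ] _) = a.prod (b.prod L) := by
  have hsurj : Function.Surjective (a.prod b) := by
    rintro ⟨u, v⟩
    obtain ⟨e, rfl⟩ := ha u
    have : v - b e ∈ Submodule.map b.toLinearMap (LinearMap.ker a.toLinearMap) := by rw [hb]; trivial
    obtain ⟨e', he', h2⟩ := this
    have he'' : a e' = 0 := he'
    have h2' : b e' = v - b e := h2
    refine ⟨e + e', ?_⟩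
    simp [he'', h2']
  have hr := LinearMap.finrank_range_add_finrank_ker (a.prod b).toLinearMap
  have hrange : LinearMap.range (a.prod b).toLinearMap = ⊤ := LinearMap.range_eq_top.2 hsurj
  rw [hrange, finrank_top] at hr
  simp only [Module.finrank_prod, Module.finrank_fintype_fun_eq_card, Fintype.card_fin] at hr
  have hk : Module.finrank ℂ (LinearMap.ker (a.prod b).toLinearMap) = 1 := by omega
  obtain ⟨κ, hκ0, hκ⟩ := finrank_eq_one_iff'.1 hk
  have : ∃ i, (κ : Fin N → ℂ) i ≠ 0 := by
    by_contra! h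
    apply hκ0
    ext i
    exact h i
  obtain ⟨i, hi⟩ := this
  let L : (Fin N → ℂ) →L[ℂ] ℂ := ContinuousLinearMap.proj i
  let f := a.prod (b.prod L)
  have hinj : Function.Injective f.toLinearMap := by
    rw [← LinearMap.ker_eq_bot, LinearMap.ker_eq_bot']
    intro m hm
    have hm' : (a m, b m, m i) = 0 := hm
    simp only [Prod.mk_eq_zero] at hm'
    obtain ⟨c, hc⟩ := hκ ⟨m, by
      rw [LinearMap.mem_ker]
      change (a m, b m) = 0
      rw [hm'.1, hm'.2.1]; rfl⟩
    have hc' : c • (κ : Fin N → ℂ) = m := congrArg Subtype.val hc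
    have h3 := hm'.2.2
    rw [← hc', Pi.smul_apply, smul_eq_mul, mul_eq_zero] at h3
    rcases h3 with h3 | h3
    · rw [← hc', h3, zero_smul]
    · exact absurd h3 hi
  let e := LinearMap.linearEquivOfInjective f.toLinearMap hinj (by
    simp only [Module.finrank_prod, Module.finrank_fintype_fun_eq_card, Fintype.card_fin,
      Module.finrank_self]; omega)
  refine ⟨L, e.toContinuousLinearEquiv, ?_⟩
  ext1 m
  rfl

theorem local_product {N n : ℕ} (hNn : n + 1 ≤ N)
    {M : Set (Fin N → ℂ)} {p : (Fin N → ℂ) → (Fin n → ℂ)}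
    (hphol : ∃ U, IsOpen U ∧ M ⊆ U ∧ DifferentiableOn ℂ p U)
    {x : Fin N → ℂ} (hx : x ∈ M) (hsub : SubmersionAt (N - (n + 1)) M p x) :
    ∃ (L : (Fin N → ℂ) →L[ℂ] ℂ) (Ω : Set (Fin N → ℂ)) (O : Set ((Fin n → ℂ) × ℂ))
      (Γ : (Fin n → ℂ) × ℂ → (Fin N → ℂ)), IsOpen Ω ∧ x ∈ Ω ∧ IsOpen O ∧ DifferentiableOn ℂ Γ O ∧
      (∀ q ∈ O, Γ q ∈ M ∧ p (Γ q) = q.1 ∧ L (Γ q) = q.2) ∧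
      (∀ z ∈ M ∩ Ω, (p z, L z) ∈ O ∧ Γ (p z, L z) = z) := by
  obtain ⟨U, hUo, hMU, hpU⟩ := hphol
  obtain ⟨W, g, ⟨hWo, hxW, hgW, hgs, hMW⟩, hmap⟩ := hsub
  have hg0 : ∀ z ∈ W, z ∈ M ↔ g z = 0 := by
    intro z hz
    have : z ∈ M ∩ W ↔ z ∈ {y ∈ W | g y = 0} := by rw [hMW]
    simpa [hz] using this
  have hgx := hgs x hxW ((hg0 x hxW).1 hx)
  obtain ⟨L, e, he⟩ := exists_lin (by omega : N = (N - (n+1)) + n + 1) _ _ hgx hmap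
  let f : (Fin N → ℂ) → (Fin (N - (n+1)) → ℂ) × (Fin n → ℂ) × ℂ := fun z => (g z, p z, L z)
  have hfd : DifferentiableOn ℂ f (W ∩ U) :=
    (hgW.mono inter_subset_left).prodMk ((hpU.mono inter_subset_right).prodMk
      L.differentiable.differentiableOn)
  have hgd := (hgW.differentiableAt (hWo.mem_nhds hxW)).hasFDerivAt
  have hpd := (hpU.differentiableAt (hUo.mem_nhds (hMU hx))).hasFDerivAt
  have hfx : fderiv ℂ f x = e := by
    rw [he]
    exact (hgd.prodMk (hpd.prodMk L.hasFDerivAt)).fderiv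
  obtain ⟨Φ, hΦ, hxΦ, hΦU, hΦd⟩ := inv_thm (hWo.inter hUo) hfd ⟨hxW, hMU hx⟩ e hfx
  have hcj : Continuous (fun q : (Fin n → ℂ) × ℂ => ((0 : Fin (N - (n+1)) → ℂ), q)) := by fun_prop
  refine ⟨L, Φ.source, (fun q => ((0 : Fin (N - (n+1)) → ℂ), q)) ⁻¹' Φ.target,
    fun q => Φ.symm (0, q), Φ.open_source, hxΦ, Φ.open_target.preimage hcj, ?_, ?_, ?_⟩
  · refine hΦd.comp ?_ (fun q hq => hq)
    fun_prop
  · intro q hq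
    have h1 := Φ.map_target hq
    have h2 : f (Φ.symm (0, q)) = (0, q) := by rw [← hΦ]; exact Φ.right_inv hq
    simp only [f, Prod.ext_iff] at h2
    refine ⟨(hg0 _ (hΦU h1).1).2 h2.1, h2.2.1, h2.2.2⟩
  · rintro z ⟨hzM, hz⟩
    have h1 := Φ.map_source hz
    have h2 := Φ.left_inv hz
    rw [hΦ] at h1 h2
    have h3 : f z = (0, p z, L z) := by
      simp only [f, (hg0 z (hΦU hz).1).1 hzM]
    rw [h3] at h1 h2
    exact ⟨h1, h2⟩

end AS
end
end

section
open Filter Set Topology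
noncomputable section
namespace AS
open scoped ContDiff

def D1 (u : ℝ × ℝ → ℝ) (z : ℝ × ℝ) : ℝ := fderiv ℝ u z (1, 0)

theorem D1_smooth {D : Set (ℝ × ℝ)} (hD : IsOpen D) {u : ℝ × ℝ → ℝ} (hu : ContDiffOn ℝ ∞ u D) :
    ContDiffOn ℝ ∞ (D1 u) D :=
  ((contDiffOn_infty_iff_fderiv_of_isOpen hD).1 hu).2.clm_apply contDiffOn_const

theorem D1_has {D : Set (ℝ × ℝ)} (hD : IsOpen D) {u : ℝ × ℝ → ℝ} (hu : ContDiffOn ℝ ∞ u D)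
    {s y : ℝ} (h : (s, y) ∈ D) : HasDerivAt (fun s => u (s, y)) (D1 u (s, y)) s := by
  have h1 : HasFDerivAt u (fderiv ℝ u (s, y)) (s, y) :=
    ((((contDiffOn_infty_iff_fderiv_of_isOpen hD).1 hu).1).differentiableAt (hD.mem_nhds h)).hasFDerivAt
  have h2 : HasDerivAt (fun s : ℝ => (s, y)) (1, 0) s := (hasDerivAt_id s).prodMk (hasDerivAt_const s y)
  exact h1.comp_hasDerivAt s h2

def qq {N : ℕ} (z : Fin N → ℂ) : ℝ := ∑ i, ‖z i‖ ^ 2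

theorem qq_smooth (N : ℕ) : ContDiff ℝ ∞ (qq (N := N)) := by
  unfold qq
  apply ContDiff.sum
  intro i _
  apply ContDiff.norm_sq ℝ
  fun_prop

theorem qq_cont (N : ℕ) : Continuous (qq (N := N)) := (qq_smooth N).continuous

theorem lap1 {O : Set ℂ} (hO : IsOpen O) {g : ℂ → ℂ} (hg : DifferentiableOn ℂ g O) {w0 : ℂ}
    (hw : w0 ∈ O) (e : ℂ) :
    (∀ᶠ s : ℝ in 𝓝 0, HasDerivAt (fun s : ℝ => ‖g (w0 + s * e)‖ ^ 2)
      (2 * inner ℝ (g (w0 + s * e)) (deriv g (w0 + s * e) * e)) s) ∧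
    HasDerivAt (fun s : ℝ => 2 * inner ℝ (g (w0 + s * e)) (deriv g (w0 + s * e) * e))
      (2 * (inner ℝ (g w0) (deriv (deriv g) w0 * e * e) + inner ℝ (deriv g w0 * e) (deriv g w0 * e))) 0 := by
  have hl : ∀ s : ℝ, HasDerivAt (fun ζ : ℂ => w0 + ζ * e) e (s : ℂ) := by
    intro s
    simpa using ((hasDerivAt_id (s : ℂ)).mul_const e).const_add w0
  have hc : Continuous (fun s : ℝ => w0 + s * e) := by fun_prop
  have hev : ∀ᶠ s : ℝ in 𝓝 0, w0 + s * e ∈ O :=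
    hc.continuousAt.eventually_mem (hO.mem_nhds (by simpa using hw))
  have key : ∀ (f : ℂ → ℂ), DifferentiableOn ℂ f O → ∀ s : ℝ, w0 + s * e ∈ O →
      HasDerivAt (fun s : ℝ => f (w0 + s * e)) (deriv f (w0 + s * e) * e) s := by
    intro f hf s hs
    have h1 := (hf.differentiableAt (hO.mem_nhds hs)).hasDerivAt
    exact (h1.comp (s : ℂ) (hl s)).comp_ofReal
  refine ⟨?_, ?_⟩
  · filter_upwards [hev] with s hs
    exact (key g hg s hs).norm_sq
  · have h0 : w0 + ((0 : ℝ) : ℂ) * e ∈ O := by simpa using hw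
    have h1 := key g hg 0 h0
    have h2 := (key (deriv g) (hg.deriv hO) 0 h0).mul_const e
    have := (h1.inner ℝ h2).const_mul 2
    simpa using this

theorem lap {N : ℕ} {O : Set ℂ} (hO : IsOpen O) {γ : ℂ → Fin N → ℂ} (hγ : DifferentiableOn ℂ γ O)
    {w0 : ℂ} (hw : w0 ∈ O) (h0 : deriv γ w0 ≠ 0) :
    ∃ e : ℂ, e ≠ 0 ∧ ∃ F1 : ℝ → ℝ, ∃ F2 : ℝ, 0 < F2 ∧
      (∀ᶠ s : ℝ in 𝓝 0, HasDerivAt (fun s : ℝ => qq (γ (w0 + s * e))) (F1 s) s) ∧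
      HasDerivAt F1 F2 0 := by
  have hg : ∀ i, DifferentiableOn ℂ (fun w => γ w i) O := fun i => by
    intro w hw
    exact (differentiableWithinAt_pi.1 (hγ w hw)) i
  let F2 : ℂ → ℝ := fun e => ∑ i, (2 * (inner ℝ (γ w0 i) (deriv (deriv (fun w => γ w i)) w0 * e * e)
      + inner ℝ (deriv (fun w => γ w i) w0 * e) (deriv (fun w => γ w i) w0 * e)))
  have main : ∀ e : ℂ, e ≠ 0 → 0 < F2 e → ∃ e : ℂ, e ≠ 0 ∧ ∃ F1 : ℝ → ℝ, ∃ F2 : ℝ, 0 < F2 ∧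
      (∀ᶠ s : ℝ in 𝓝 0, HasDerivAt (fun s : ℝ => qq (γ (w0 + s * e))) (F1 s) s) ∧
      HasDerivAt F1 F2 0 := by
    intro e he hF
    refine ⟨e, he, fun s => ∑ i, 2 * inner ℝ (γ (w0 + s * e) i) (deriv (fun w => γ w i) (w0 + s * e) * e),
      F2 e, hF, ?_, ?_⟩
    · have : ∀ᶠ s : ℝ in 𝓝 0, ∀ i, HasDerivAt (fun s : ℝ => ‖γ (w0 + s * e) i‖ ^ 2)
          (2 * inner ℝ (γ (w0 + s * e) i) (deriv (fun w => γ w i) (w0 + s * e) * e)) s := by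
        rw [eventually_all]
        intro i
        exact (lap1 hO (hg i) hw e).1
      filter_upwards [this] with s hs
      exact HasDerivAt.fun_sum (fun i _ => hs i)
    · exact HasDerivAt.fun_sum (fun i _ => (lap1 hO (hg i) hw e).2)
  have hsum : 0 < F2 1 + F2 Complex.I := by
    simp only [F2]
    rw [← Finset.sum_add_distrib]
    have e1 : ∀ a : ℂ, a * Complex.I * Complex.I = - a := by
      intro a; rw [mul_assoc, Complex.I_mul_I]; ring
    have : ∀ i, (2 * (inner ℝ (γ w0 i) (deriv (deriv (fun w => γ w i)) w0 * 1 * 1)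
      + inner ℝ (deriv (fun w => γ w i) w0 * 1) (deriv (fun w => γ w i) w0 * 1))) +
      (2 * (inner ℝ (γ w0 i) (deriv (deriv (fun w => γ w i)) w0 * Complex.I * Complex.I)
      + inner ℝ (deriv (fun w => γ w i) w0 * Complex.I) (deriv (fun w => γ w i) w0 * Complex.I)))
      = 4 * ‖deriv (fun w => γ w i) w0‖ ^ 2 := by
      intro i
      rw [e1, real_inner_self_eq_norm_sq, real_inner_self_eq_norm_sq, inner_neg_right]
      simp; ring
    rw [Finset.sum_congr rfl (fun i _ => this i)]
    obtain ⟨i, hi⟩ := Function.ne_iff.1 h0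
    have hd : deriv γ w0 i = deriv (fun w => γ w i) w0 := by
      have h1 := (hγ.differentiableAt (hO.mem_nhds hw)).hasDerivAt
      exact ((hasDerivAt_pi.1 h1) i).deriv.symm
    apply Finset.sum_pos' (fun i _ => by positivity)
    refine ⟨i, Finset.mem_univ _, ?_⟩
    rw [← hd]
    have : 0 < ‖deriv γ w0 i‖ := norm_pos_iff.2 hi
    positivity
  by_cases h1 : 0 < F2 1
  · exact main 1 one_ne_zero h1
  · exact main Complex.I Complex.I_ne_zero (by linarith)

def HasCharts {N : ℕ} (X : Set (Fin N → ℂ)) : Prop :=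
  ∀ x ∈ X, ∃ (L : (Fin N → ℂ) →L[ℂ] ℂ) (Ω : Set (Fin N → ℂ)) (O : Set ℂ) (γ : ℂ → (Fin N → ℂ)),
    IsOpen Ω ∧ x ∈ Ω ∧ IsOpen O ∧ DifferentiableOn ℂ γ O ∧
    (∀ w ∈ O, γ w ∈ X ∧ L (γ w) = w) ∧ (∀ z ∈ X ∩ Ω, L z ∈ O ∧ γ (L z) = z)

theorem box {N : ℕ} {X : Set (Fin N → ℂ)} (hX : HasCharts X) {x : Fin N → ℂ} (hx : x ∈ X) :
    ∃ (κ : ℝ × ℝ → (Fin N → ℂ)) (l : (Fin N → ℂ) → ℝ × ℝ) (Ω : Set (Fin N → ℂ)) (D : Set (ℝ × ℝ))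
      (ρ c : ℝ), 0 < ρ ∧ 0 < c ∧ IsOpen D ∧ Metric.closedBall 0 ρ ⊆ D ∧ ContDiffOn ℝ ∞ κ D ∧
      Continuous l ∧ IsOpen Ω ∧ x ∈ Ω ∧ l x = 0 ∧ (∀ u ∈ D, κ u ∈ X ∧ κ u ∈ Ω ∧ l (κ u) = u) ∧
      (∀ z ∈ X ∩ Ω, κ (l z) = z) ∧
      (∀ u ∈ Metric.closedBall 0 ρ, c ≤ D1 (D1 (fun v => qq (κ v))) u) := by
  obtain ⟨L, Ω, O, γ, hΩ, hxΩ, hO, hγ, h1, h2⟩ := hX x hx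
  have hw := (h2 x ⟨hx, hxΩ⟩).1
  set w0 := L x with hw0
  have hγx : γ w0 = x := (h2 x ⟨hx, hxΩ⟩).2
  have hγd := (hγ.differentiableAt (hO.mem_nhds hw)).hasDerivAt
  have hne : deriv γ w0 ≠ 0 := by
    intro h0
    have h3 : HasDerivAt (fun w => L (γ w)) (L (deriv γ w0)) w0 :=
      L.hasFDerivAt.comp_hasDerivAt w0 hγd
    have h4 : HasDerivAt (fun w => L (γ w)) 1 w0 := by
      refine (hasDerivAt_id w0).congr_of_eventuallyEq ?_
      filter_upwards [hO.mem_nhds hw] with w hw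
      exact (h1 w hw).2
    have := h3.unique h4
    rw [h0, map_zero] at this
    exact zero_ne_one this
  obtain ⟨e, he, F1, F2, hF2, hF, hF1⟩ := lap hO hγ hw hne
  let m : ℝ × ℝ → ℂ := fun u => w0 + (u.1 + u.2 * Complex.I) * e
  have hm : ContDiff ℝ ∞ m := by
    have : ContDiff ℝ ∞ (fun u : ℝ => (u : ℂ)) := Complex.ofRealCLM.contDiff
    have h1 : ContDiff ℝ ∞ (fun u : ℝ × ℝ => ((u.1 : ℝ) : ℂ)) := this.comp contDiff_fst
    have h2 : ContDiff ℝ ∞ (fun u : ℝ × ℝ => ((u.2 : ℝ) : ℂ)) := this.comp contDiff_snd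
    exact contDiff_const.add ((h1.add (h2.mul contDiff_const)).mul contDiff_const)
  let l : (Fin N → ℂ) → ℝ × ℝ := fun z => (((L z - w0) * e⁻¹).re, ((L z - w0) * e⁻¹).im)
  have hl : Continuous l := by
    have h3 : Continuous (fun z => (L z - w0) * e⁻¹) := by fun_prop
    exact (Complex.continuous_re.comp h3).prodMk (Complex.continuous_im.comp h3)
  have hml : ∀ z, m (l z) = L z := by
    intro z
    simp only [m, l, Complex.re_add_im]
    field_simp; ring
  have hlm : ∀ z u, L z = m u → l z = u := by
    intro z u h
    simp only [l, h, m]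
    have : (w0 + (↑u.1 + ↑u.2 * Complex.I) * e - w0) * e⁻¹ = u.1 + u.2 * Complex.I := by
      field_simp; ring
    rw [this]; simp
  have hD0 : IsOpen (m ⁻¹' O) := hO.preimage hm.continuous
  have hγR : ContDiffOn ℝ ∞ γ O := (hγ.contDiffOn hO).restrict_scalars ℝ
  have hκ0 : ContDiffOn ℝ ∞ (fun u => γ (m u)) (m ⁻¹' O) := hγR.comp hm.contDiffOn (fun u hu => hu)
  let D := m ⁻¹' O ∩ (fun u => γ (m u)) ⁻¹' Ω
  have hD : IsOpen D := hκ0.continuousOn.isOpen_inter_preimage hD0 hΩ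
  have hκ : ContDiffOn ℝ ∞ (fun u => γ (m u)) D := hκ0.mono inter_subset_left
  have hm0 : m 0 = w0 := by simp [m]
  have h0D : (0 : ℝ × ℝ) ∈ D := by
    refine ⟨by rw [mem_preimage, hm0]; exact hw, ?_⟩
    rw [mem_preimage, hm0, hγx]; exact hxΩ
  have hu : ContDiffOn ℝ ∞ (fun v => qq (γ (m v))) D := (qq_smooth N).comp_contDiffOn hκ
  have hD2 : D1 (D1 (fun v => qq (γ (m v)))) 0 = F2 := by
    have a1 := D1_has hD (D1_smooth hD hu) (s := 0) (y := 0) h0D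
    refine a1.unique (hF1.congr_of_eventuallyEq ?_)
    have hc : ContinuousAt (fun s : ℝ => (s, (0:ℝ))) 0 := by fun_prop
    filter_upwards [hF, hc.eventually_mem (hD.mem_nhds h0D)] with s hs hsD
    refine (D1_has hD hu hsD).unique ?_
    have : (fun s : ℝ => qq (γ (m (s, 0)))) = fun s : ℝ => qq (γ (w0 + s * e)) := by
      funext s; simp [m]
    rw [this]; exact hs
  have hcD2 : ContinuousAt (D1 (D1 (fun v => qq (γ (m v))))) 0 :=
    (D1_smooth hD (D1_smooth hD hu)).continuousOn.continuousAt (hD.mem_nhds h0D)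
  have hev : ∀ᶠ u in 𝓝 (0 : ℝ × ℝ), u ∈ D ∧ F2 / 2 < D1 (D1 (fun v => qq (γ (m v)))) u := by
    refine Filter.Eventually.and (hD.mem_nhds h0D) (hcD2.eventually_const_lt ?_)
    rw [hD2]; linarith
  obtain ⟨ρ, hρ, hρ'⟩ := Metric.nhds_basis_closedBall.eventually_iff.1 hev
  refine ⟨fun u => γ (m u), l, Ω, D, ρ, F2 / 2, hρ, by linarith, hD, fun u hu => (hρ' hu).1, hκ, hl, hΩ,
    hxΩ, ?_, ?_, ?_, fun u hu => (hρ' hu).2.le⟩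
  · simp [l, hw0]
  · intro u hu
    have := h1 (m u) hu.1
    exact ⟨this.1, hu.2, hlm _ _ this.2⟩
  · intro z hz
    simp only [hml]
    exact (h2 z hz).2

end AS
end
end

section
open Filter Set Topology
noncomputable section
namespace AS
open scoped ContDiff

variable {V : Type*} [AddCommGroup V]

theorem slice_ball (ρ y : ℝ) : {s : ℝ | (s, y) ∈ Metric.ball (0 : ℝ × ℝ) ρ} =
    {s | |s| < ρ ∧ |y| < ρ} := by
  ext s
  simp [Prod.norm_def]

theorem slice_open (ρ y : ℝ) : IsOpen {s : ℝ | (s, y) ∈ Metric.ball (0 : ℝ × ℝ) ρ} :=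
  Metric.isOpen_ball.preimage (by fun_prop : Continuous fun s : ℝ => (s, y))

theorem slice_conv (ρ y : ℝ) : Convex ℝ {s : ℝ | (s, y) ∈ Metric.ball (0 : ℝ × ℝ) ρ} := by
  have h := convex_ball (0 : ℝ × ℝ) ρ
  rw [slice_ball]
  by_cases hy : |y| < ρ
  · simp only [hy, and_true]
    have : {s : ℝ | |s| < ρ} = Ioo (-ρ) ρ := by ext s; simp [abs_lt]
    rw [this]; exact convex_Ioo _ _
  · simp [hy, convex_empty]

theorem slice_convexOn {D : Set (ℝ × ℝ)} (hD : IsOpen D) {ρ ε : ℝ} (hρ : Metric.closedBall 0 ρ ⊆ D)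
    {u v : ℝ × ℝ → ℝ} (hu : ContDiffOn ℝ ∞ u D) (hv : ContDiffOn ℝ ∞ v D)
    (h : ∀ z ∈ Metric.closedBall 0 ρ, ε * D1 (D1 v) z ≤ D1 (D1 u) z) (y : ℝ) :
    ConvexOn ℝ {s : ℝ | (s, y) ∈ Metric.ball (0 : ℝ × ℝ) ρ} (fun s => u (s, y) - ε * v (s, y)) := by
  have hb : ∀ s, (s, y) ∈ Metric.ball (0 : ℝ × ℝ) ρ → (s, y) ∈ D := fun s hs =>
    hρ (Metric.ball_subset_closedBall hs)
  have h1 : ∀ s, (s, y) ∈ Metric.ball (0 : ℝ × ℝ) ρ → HasDerivAt (fun s => u (s, y) - ε * v (s, y))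
      (D1 u (s, y) - ε * D1 v (s, y)) s := fun s hs =>
    (D1_has hD hu (hb s hs)).sub ((D1_has hD hv (hb s hs)).const_mul ε)
  have h2 : ∀ s, (s, y) ∈ Metric.ball (0 : ℝ × ℝ) ρ → HasDerivAt (fun s => D1 u (s, y) - ε * D1 v (s, y))
      (D1 (D1 u) (s, y) - ε * D1 (D1 v) (s, y)) s := fun s hs =>
    (D1_has hD (D1_smooth hD hu) (hb s hs)).sub ((D1_has hD (D1_smooth hD hv) (hb s hs)).const_mul ε)
  refine convexOn_of_hasDerivWithinAt2_nonneg (slice_conv ρ y)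
    (fun s hs => (h1 s hs).continuousAt.continuousWithinAt)
    (f' := fun s => D1 u (s, y) - ε * D1 v (s, y))
    (f'' := fun s => D1 (D1 u) (s, y) - ε * D1 (D1 v) (s, y)) ?_ ?_ ?_
  · rw [(slice_open ρ y).interior_eq]
    exact fun s hs => (h1 s hs).hasDerivWithinAt
  · rw [(slice_open ρ y).interior_eq]
    exact fun s hs => (h2 s hs).hasDerivWithinAt
  · rw [(slice_open ρ y).interior_eq]
    exact fun s hs => sub_nonneg.2 (h _ (Metric.ball_subset_closedBall hs))

theorem exact_box {N : ℕ} {X Ω : Set (Fin N → ℂ)} {κ : ℝ × ℝ → (Fin N → ℂ)}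
    {l : (Fin N → ℂ) → ℝ × ℝ} {D : Set (ℝ × ℝ)} {ρ r : ℝ}
    (hρ : Metric.closedBall 0 ρ ⊆ D) (hκ : ContinuousOn κ D) (hl : Continuous l)
    (h1 : ∀ u ∈ D, κ u ∈ X ∧ κ u ∈ Ω ∧ l (κ u) = u) (h2 : ∀ z ∈ X ∩ Ω, κ (l z) = z)
    {ψ : (Fin N → ℂ) → ℝ} (hψ : Continuous ψ)
    (hc : ∀ y, ConvexOn ℝ {s : ℝ | (s, y) ∈ Metric.ball (0 : ℝ × ℝ) ρ} (fun s => ψ (κ (s, y))))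
    {A : (Fin N → ℂ) → (Fin N → ℂ) → V} (hA : IsCoc A (X ∩ {z | ψ z < r})) :
    ∃ g, IsPrim A g ((X ∩ {z | ψ z < r}) ∩ (Ω ∩ l ⁻¹' Metric.ball 0 ρ)) := by
  let S : Set (ℝ × ℝ) := Metric.ball 0 ρ ∩ (fun u => ψ (κ u)) ⁻¹' Iio r
  have hbD : Metric.ball (0 : ℝ × ℝ) ρ ⊆ D := Metric.ball_subset_closedBall.trans hρ
  have hS : IsOpen S :=
    (hψ.comp_continuousOn (hκ.mono hbD)).isOpen_inter_preimage Metric.isOpen_ball isOpen_Iio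
  have hA' := hA.pull (f := κ) (S' := S) (hκ.mono (inter_subset_left.trans hbD))
    (fun u hu => ⟨(h1 u (hbD hu.1)).1, hu.2⟩)
  obtain ⟨g, hg⟩ := hA'.exact_slices hS (fun y => (hc y).convex_lt r)
  have := hg.pull (f := l) (S' := (X ∩ {z | ψ z < r}) ∩ (Ω ∩ l ⁻¹' Metric.ball 0 ρ)) hl.continuousOn (by
    rintro z ⟨⟨hz, hz'⟩, hz2, hz3⟩
    refine ⟨hz3, ?_⟩
    change ψ (κ (l z)) < r
    rw [h2 z ⟨hz, hz2⟩]; exact hz')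
  refine ⟨_, this.congr ?_⟩
  intro x hx
  refine ⟨_, self_mem_nhdsWithin, ?_⟩
  rintro a ⟨⟨ha, _⟩, ha2, _⟩ b ⟨⟨hb, _⟩, hb2, _⟩
  change _ = A (κ (l a)) (κ (l b))
  rw [h2 a ⟨ha, ha2⟩, h2 b ⟨hb, hb2⟩]

theorem box2 (V : Type*) [AddCommGroup V] {N : ℕ} {X : Set (Fin N → ℂ)} (hX : HasCharts X)
    {x : Fin N → ℂ} (hx : x ∈ X) :
    ∃ (χ : (Fin N → ℂ) → ℝ) (W : Set (Fin N → ℂ)), IsOpen W ∧ ContDiff ℝ ∞ χ ∧ (∀ z, 0 ≤ χ z) ∧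
      χ x = 1 ∧ tsupport χ ⊆ W ∧
      ∀ f : (Fin N → ℂ) → ℝ, ContDiff ℝ ∞ f → ∀ᶠ ε in 𝓝[>] (0:ℝ),
        ∀ (r : ℝ) (A : (Fin N → ℂ) → (Fin N → ℂ) → V), IsCoc A (X ∩ {z | qq z - ε * f z < r}) →
          ∃ g, IsPrim A g ((X ∩ {z | qq z - ε * f z < r}) ∩ W) := by
  obtain ⟨κ, l, Ω, D, ρ, c, hρ0, hc, hD, hρ, hκ, hl, hΩ, hxΩ, hlx, h1, h2, h3⟩ := box hX hx
  have hW : IsOpen (Ω ∩ l ⁻¹' Metric.ball 0 ρ) := hΩ.inter (Metric.isOpen_ball.preimage hl)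
  have hxW : x ∈ Ω ∩ l ⁻¹' Metric.ball 0 ρ := ⟨hxΩ, by rw [mem_preimage, hlx]; simpa using hρ0⟩
  obtain ⟨χ, hs, -, hχ, hr, hx1⟩ := exists_contDiff_tsupport_subset (n := (⊤ : ℕ∞)) (hW.mem_nhds hxW)
  refine ⟨χ, _, hW, hχ, fun z => (hr (mem_range_self z)).1, hx1, hs, ?_⟩
  intro f hf
  have hu : ContDiffOn ℝ ∞ (fun v => qq (κ v)) D := (qq_smooth N).comp_contDiffOn hκ
  have hv : ContDiffOn ℝ ∞ (fun v => f (κ v)) D := hf.comp_contDiffOn hκ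
  have hcont := ((D1_smooth hD (D1_smooth hD hv)).continuousOn).mono hρ
  obtain ⟨C, hC⟩ := (isCompact_closedBall (0 : ℝ × ℝ) ρ).exists_bound_of_continuousOn hcont
  have hC0 : 0 ≤ C := (norm_nonneg _).trans (hC 0 (by simp [hρ0.le]))
  have ht : Tendsto (fun ε : ℝ => ε * C) (𝓝[>] 0) (𝓝 0) := by
    have : Continuous (fun ε : ℝ => ε * C) := by fun_prop
    simpa using (this.tendsto 0).mono_left nhdsWithin_le_nhds
  filter_upwards [self_mem_nhdsWithin, ht.eventually_lt_const hc] with ε hε hεC r A hA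
  refine exact_box hρ hκ.continuousOn hl h1 h2 ((qq_cont N).sub (continuous_const.mul hf.continuous)) ?_ hA
  refine slice_convexOn hD hρ hu hv ?_
  intro z hz
  have e1 := (le_abs_self _).trans (hC z hz)
  have e2 := h3 z hz
  have hε' : 0 ≤ ε := le_of_lt hε
  nlinarith [mul_le_mul_of_nonneg_left e1 hε']

theorem qq_compact {N : ℕ} {X : Set (Fin N → ℂ)} (hX : IsClosed X) (S : ℝ) :
    IsCompact (X ∩ {z | qq z ≤ S}) := by
  refine Metric.isCompact_of_isClosed_isBounded
    (hX.inter (isClosed_le (qq_cont N) continuous_const)) ?_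
  refine (Metric.isBounded_closedBall (x := 0) (r := |S| + 1)).subset ?_
  rintro z ⟨_, hz⟩
  rw [mem_closedBall_zero_iff, pi_norm_le_iff_of_nonneg (by positivity)]
  intro i
  have h1 : ‖z i‖ ^ 2 ≤ qq z :=
    Finset.single_le_sum (f := fun i => ‖z i‖ ^ 2) (fun _ _ => by positivity) (Finset.mem_univ i)
  have h2 : qq z ≤ S := hz
  nlinarith [le_abs_self S, abs_nonneg S, norm_nonneg (z i)]

theorem step {N : ℕ} {X : Set (Fin N → ℂ)} (hXc : IsClosed X) (hX : HasCharts X) (S : ℝ) :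
    ∃ ε > 0, ε ≤ 1 ∧ ∀ r, r + ε ≤ S → ∀ A : (Fin N → ℂ) → (Fin N → ℂ) → V, IsCoc A (X ∩ {z | qq z < r}) →
      ∃ B, IsCoc B (X ∩ {z | qq z < r + ε}) ∧ LocEq B A (X ∩ {z | qq z < r}) := by
  classical
  let K := X ∩ {z | qq z ≤ S}
  have hK : IsCompact K := qq_compact hXc S
  choose χ W hW hχ hχ0 hχ1 hsupp hex using fun x : K => box2 V hX x.2.1
  obtain ⟨t, ht⟩ := hK.elim_finite_subcover (fun x : K => {z | 1 / 2 < χ x z})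
    (fun x => isOpen_lt continuous_const (hχ x).continuous)
    (fun z hz => mem_iUnion.2 ⟨⟨z, hz⟩, by
      have : χ ⟨z, hz⟩ z = 1 := hχ1 ⟨z, hz⟩
      change 1 / 2 < χ ⟨z, hz⟩ z
      rw [this]; norm_num⟩)
  let f : Finset K → (Fin N → ℂ) → ℝ := fun s z => ∑ j ∈ s, χ j z
  have hf : ∀ s, ContDiff ℝ ∞ (f s) := fun s => ContDiff.sum (fun j _ => hχ j)
  have hev : ∀ᶠ ε in 𝓝[>] (0:ℝ), ∀ i ∈ t, ∀ s ∈ t.powerset,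
      ∀ (r : ℝ) (A : (Fin N → ℂ) → (Fin N → ℂ) → V), IsCoc A (X ∩ {z | qq z - ε * f s z < r}) →
          ∃ g, IsPrim A g ((X ∩ {z | qq z - ε * f s z < r}) ∩ W i) := by
    rw [eventually_all_finset]
    intro i _
    rw [eventually_all_finset]
    intro s _
    exact hex i (f s) (hf s)
  obtain ⟨ε, ⟨hε0, hε1⟩, hε⟩ := (Filter.Eventually.and (Ioo_mem_nhdsGT (zero_lt_one' ℝ)) hev).exists
  refine ⟨ε / 2, by positivity, by linarith, ?_⟩
  intro r hr A hA
  have ind : ∀ s : Finset K, s ⊆ t → ∃ B, IsCoc B (X ∩ {z | qq z - ε * f s z < r}) ∧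
      LocEq B A (X ∩ {z | qq z < r}) := by
    intro s
    induction s using Finset.induction_on with
    | empty =>
      intro _
      refine ⟨A, by simpa [f] using hA, fun x _ => ⟨univ, univ_mem, fun _ _ _ _ => rfl⟩⟩
    | insert i s hi ih =>
      intro hs
      obtain ⟨hit, hst⟩ := Finset.insert_subset_iff.1 hs
      obtain ⟨B, hB, hBA⟩ := ih hst
      obtain ⟨g, hg⟩ := hε i hit s (Finset.mem_powerset.2 hst) r B hB
      have hfi : ∀ z, f (insert i s) z = χ i z + f s z := fun z => Finset.sum_insert hi
      have hf0 : ∀ z, 0 ≤ f s z := fun z => Finset.sum_nonneg (fun j _ => hχ0 j z)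
      have hopen : ∀ s, IsOpen {z | qq z - ε * f s z < r} := fun s =>
        isOpen_lt ((qq_cont N).sub (continuous_const.mul (hf s).continuous)) continuous_const
      have hsub : X ∩ {z | qq z - ε * f s z < r} ⊆ X ∩ {z | qq z - ε * f (insert i s) z < r} := by
        rintro z ⟨hz, hz2⟩
        refine ⟨hz, ?_⟩
        have hz2 : qq z - ε * f s z < r := hz2
        change qq z - ε * f (insert i s) z < r
        rw [hfi]
        nlinarith [mul_nonneg hε0.le (hχ0 i z)]
      set X' := X ∩ {z | qq z - ε * f (insert i s) z < r} with hX'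
      obtain ⟨B', hB', hB'B⟩ := hB.glue (X := X') (W := X' ∩ W i) (W' := X' ∩ {z | 0 < χ i z}) (g := g)
        (fun x hx => by
          have := mem_nhdsWithin_of_mem_nhds (t := X') ((hopen s).mem_nhds hx.2)
          filter_upwards [this, self_mem_nhdsWithin] with z h1 h2
          exact ⟨h2.1, h1⟩)
        (fun x hx => inter_mem self_mem_nhdsWithin
          (mem_nhdsWithin_of_mem_nhds
            ((isOpen_lt continuous_const (hχ i).continuous).mem_nhds hx.2)))
        (fun x hx => inter_mem self_mem_nhdsWithin
          (mem_nhdsWithin_of_mem_nhds ((hW i).mem_nhds hx.2)))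
        hsub
        (fun z hz => by
          by_cases h : 0 < χ i z
          · exact Or.inr ⟨hz, h⟩
          · left
            refine ⟨hz.1, ?_⟩
            have h0 : χ i z = 0 := le_antisymm (not_lt.1 h) (hχ0 i z)
            have := hz.2
            change qq z - ε * f (insert i s) z < r at this
            rw [hfi, h0, zero_add] at this
            exact this)
        (by
          rintro z ⟨hz, hz2⟩
          refine ⟨hz, hsupp i ?_⟩
          refine closure_mono ?_ hz2
          rintro w ⟨_, hw⟩
          exact (ne_of_gt hw : χ i w ≠ 0))
        (hg.mono (fun z hz => ⟨hz.1, hz.2.2⟩))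
      refine ⟨B', hB', (hB'B.mono ?_).trans hBA⟩
      rintro z ⟨hz, hz2⟩
      refine ⟨hz, ?_⟩
      have hz2 : qq z < r := hz2
      change qq z - ε * f s z < r
      nlinarith [mul_nonneg hε0.le (hf0 z)]
  obtain ⟨B, hB, hBA⟩ := ind t subset_rfl
  refine ⟨B, hB.mono ?_, hBA⟩
  rintro z ⟨hz, hz2⟩
  refine ⟨hz, ?_⟩
  have hz2 : qq z < r + ε / 2 := hz2
  obtain ⟨i, hi, hi2⟩ := mem_iUnion₂.1 (ht ⟨hz, (by linarith : qq z ≤ S)⟩)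
  have hi2 : 1 / 2 < χ i z := hi2
  have : χ i z ≤ f t z := Finset.single_le_sum (f := fun j => χ j z) (fun j _ => hχ0 j z) hi
  change qq z - ε * f t z < r
  nlinarith

theorem step_to {N : ℕ} {X : Set (Fin N → ℂ)} (hXc : IsClosed X) (hX : HasCharts X) (r S : ℝ)
    (hrS : r ≤ S) (A : (Fin N → ℂ) → (Fin N → ℂ) → V) (hA : IsCoc A (X ∩ {z | qq z < r})) :
    ∃ B, IsCoc B (X ∩ {z | qq z < S}) ∧ LocEq B A (X ∩ {z | qq z < r}) := by
  obtain ⟨ε, hε, hε1, h⟩ := step (V := V) hXc hX (S + 1)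
  have ind : ∀ k : ℕ, ∃ B, IsCoc B (X ∩ {z | qq z < min (r + k * ε) S}) ∧ LocEq B A (X ∩ {z | qq z < r}) := by
    intro k
    induction k with
    | zero =>
      exact ⟨A, by simpa [hrS] using hA, fun x _ => ⟨univ, univ_mem, fun _ _ _ _ => rfl⟩⟩
    | succ k ih =>
      obtain ⟨B, hB, hBA⟩ := ih
      by_cases hk2 : S ≤ r + k * ε
      · refine ⟨B, ?_, hBA⟩
        rw [min_eq_right hk2] at hB
        refine hB.mono (fun z hz => ⟨hz.1, ?_⟩)
        have hz2 : qq z < min (r + (k + 1 : ℕ) * ε) S := hz.2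
        exact (lt_min_iff.1 hz2).2
      · push Not at hk2
        rw [min_eq_left hk2.le] at hB
        obtain ⟨C, hC, hCB⟩ := h (r + k * ε) (by linarith) B hB
        refine ⟨C, hC.mono ?_, (hCB.mono ?_).trans hBA⟩
        · rintro z ⟨hz, hz2⟩
          refine ⟨hz, ?_⟩
          have hz2 : qq z < min (r + (k + 1 : ℕ) * ε) S := hz2
          change qq z < r + k * ε + ε
          rw [lt_min_iff] at hz2
          push_cast at hz2
          linarith
        · rintro z ⟨hz, hz2⟩
          refine ⟨hz, ?_⟩
          have hz2 : qq z < r := hz2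
          change qq z < r + k * ε
          have : 0 ≤ k * ε := by positivity
          linarith
  obtain ⟨k, hk⟩ := exists_nat_gt ((S - r) / ε)
  obtain ⟨B, hB, hBA⟩ := ind k
  refine ⟨B, ?_, hBA⟩
  rw [div_lt_iff₀ hε] at hk
  rwa [min_eq_right (by linarith)] at hB

theorem extend {N : ℕ} {X : Set (Fin N → ℂ)} (hXc : IsClosed X) (hX : HasCharts X) (r : ℝ)
    (A : (Fin N → ℂ) → (Fin N → ℂ) → V) (hA : IsCoc A (X ∩ {z | qq z < r})) :
    ∃ B, IsCoc B X ∧ LocEq B A (X ∩ {z | qq z < r}) := by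
  let Q : ℕ → Set (Fin N → ℂ) := fun k => X ∩ {z | qq z < r + k}
  have hQ : ∀ k, ∀ A : (Fin N → ℂ) → (Fin N → ℂ) → V, IsCoc A (Q k) → ∃ B, IsCoc B (Q (k+1)) ∧ LocEq B A (Q k) := by
    intro k A hA
    exact step_to hXc hX (r + k) (r + (k + 1 : ℕ)) (by push_cast; linarith) A hA
  let seq : ∀ k : ℕ, {A : (Fin N → ℂ) → (Fin N → ℂ) → V // IsCoc A (Q k)} := fun k =>
    Nat.rec ⟨A, by simpa [Q] using hA⟩ (fun k B => ⟨(hQ k B.1 B.2).choose, (hQ k B.1 B.2).choose_spec.1⟩) k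
  have hs0 : (seq 0).1 = A := rfl
  have hs : ∀ k, LocEq (seq (k+1)).1 (seq k).1 (Q k) := fun k =>
    (hQ k (seq k).1 (seq k).2).choose_spec.2
  have hmono : ∀ k, Q k ⊆ Q (k+1) := by
    rintro k z ⟨hz, hz2⟩
    refine ⟨hz, ?_⟩
    have hz2 : qq z < r + k := hz2
    change qq z < r + (k + 1 : ℕ)
    push_cast; linarith
  have hmono' : Monotone Q := monotone_nat_of_le_succ hmono
  have hs' : ∀ k m, LocEq (seq (k+m)).1 (seq k).1 (Q k) := by
    intro k m
    induction m with
    | zero => exact fun x _ => ⟨univ, univ_mem, fun _ _ _ _ => rfl⟩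
    | succ m ih => exact ((hs (k+m)).mono (hmono' (Nat.le_add_right k m))).trans ih
  let kk : (Fin N → ℂ) → ℕ := fun a => ⌊max (qq a - r) 0⌋₊ + 2
  -- main local claim
  have key : ∀ x ∈ X, ∃ m, x ∈ Q m ∧ ∃ U ∈ 𝓝[X] x, ∀ a ∈ U, ∀ b ∈ U,
      (seq (kk a)).1 a b = (seq m).1 a b := by
    intro x hx
    have hxk : ∀ a, qq x - 1 < qq a → x ∈ Q (kk a) := by
      intro a ha
      refine ⟨hx, ?_⟩
      change qq x < r + ((⌊max (qq a - r) 0⌋₊ + 2 : ℕ) : ℝ)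
      have := Nat.lt_floor_add_one (max (qq a - r) 0)
      have h2 := le_max_left (qq a - r) 0
      push_cast
      linarith
    have hle : ∀ a, qq a < qq x + 1 → kk a ≤ kk x + 1 := by
      intro a ha
      simp only [kk]
      have : max (qq a - r) 0 ≤ max (qq x - r) 0 + 1 := by
        apply max_le
        · have := le_max_left (qq x - r) 0; linarith
        · have := le_max_right (qq x - r) 0; linarith
      have := Nat.floor_mono this
      rw [Nat.floor_add_one (le_max_right _ _)] at this
      omega
    have hev1 : ∀ᶠ U in (𝓝[X] x).smallSets, ∀ k ∈ Finset.range (kk x + 2), x ∈ Q k →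
        ∀ a ∈ U, ∀ b ∈ U, (seq k).1 a b = (seq (kk x + 1)).1 a b := by
      rw [eventually_all_finset]
      intro k hk
      by_cases hxQ : x ∈ Q k
      · have hk' : k ≤ kk x + 1 := by have := Finset.mem_range.1 hk; omega
        obtain ⟨m, hm⟩ := Nat.exists_eq_add_of_le hk'
        obtain ⟨U, hU, h⟩ := hs' k m x hxQ
        rw [← hm] at h
        have hQo : 𝓝[Q k] x = 𝓝[X] x := by
          refine nhdsWithin_inter_of_mem' (mem_nhdsWithin_of_mem_nhds ?_)
          exact (isOpen_lt (qq_cont N) continuous_const).mem_nhds hxQ.2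
        rw [hQo] at hU
        refine eventually_smallSets.2 ⟨U, hU, fun U' hU' _ a ha b hb => (h a (hU' ha) b (hU' hb)).symm⟩
      · exact Filter.Eventually.of_forall (fun U h => absurd h hxQ)
    obtain ⟨U, hU, hU'⟩ := eventually_smallSets.1 hev1
    have hn : {a | qq x - 1 < qq a ∧ qq a < qq x + 1} ∈ 𝓝[X] x := by
      refine mem_nhdsWithin_of_mem_nhds (((isOpen_lt continuous_const (qq_cont N)).inter
        (isOpen_lt (qq_cont N) continuous_const)).mem_nhds ⟨?_, ?_⟩)
      · change qq x - 1 < qq x; linarith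
      · change qq x < qq x + 1; linarith
    refine ⟨kk x + 1, hmono _ (hxk x (by linarith)), U ∩ {a | qq x - 1 < qq a ∧ qq a < qq x + 1}, inter_mem hU hn, ?_⟩
    rintro a ⟨ha, ha2⟩ b ⟨hb, _⟩
    exact hU' U subset_rfl (kk a) (Finset.mem_range.2 (by have := hle a ha2.2; omega)) (hxk a ha2.1) a ha b hb
  have hQn : ∀ m x, x ∈ Q m → 𝓝[Q m] x = 𝓝[X] x := by
    intro m x hxQ
    refine nhdsWithin_inter_of_mem' (mem_nhdsWithin_of_mem_nhds ?_)
    exact (isOpen_lt (qq_cont N) continuous_const).mem_nhds hxQ.2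
  refine ⟨fun a b => (seq (kk a)).1 a b, ?_, ?_⟩
  · intro x hx
    obtain ⟨m, hm, U, hU, h⟩ := key x hx
    obtain ⟨U', hU', h'⟩ := (seq m).2 x hm
    rw [hQn m x hm] at hU'
    refine ⟨U ∩ U', inter_mem hU hU', ?_⟩
    intro a ha b hb c hc
    change (seq (kk a)).1 a b + (seq (kk b)).1 b c = (seq (kk a)).1 a c
    rw [h a ha.1 b hb.1, h b hb.1 c hc.1, h a ha.1 c hc.1]
    exact h' a ha.2 b hb.2 c hc.2
  · have hQ0 : X ∩ {z | qq z < r} = Q 0 := by simp [Q]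
    rw [hQ0]
    intro x hx
    obtain ⟨m, hm, U, hU, h⟩ := key x hx.1
    obtain ⟨U', hU', h'⟩ := hs' 0 m x hx
    refine ⟨U ∩ U', inter_mem (nhdsWithin_mono _ inter_subset_left hU) hU', ?_⟩
    intro a ha b hb
    change (seq (kk a)).1 a b = A a b
    rw [h a ha.1 b hb.1, ← hs0]
    rw [zero_add] at h'
    exact h' a ha.2 b hb.2

end AS
end
end

section
open Filter Set Topology
noncomputable section
namespace AS

theorem pot_sum {Y V W : Type} [AddCommGroup W] [Module ℚ W] {s t : Y → V} {G : V → W} (z : Y →₀ ℚ)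
    (hz : z.mapDomain t = z.mapDomain s) : z.sum (fun σ q => q • (G (t σ) - G (s σ))) = 0 := by
  have h : ∀ f : Y → V, (z.mapDomain f).sum (fun v q => q • G v) = z.sum (fun σ q => q • G (f σ)) :=
    fun f => Finsupp.sum_mapDomain_index (by simp) (by intros; rw [add_smul])
  simp only [smul_sub, Finsupp.sum_sub]
  rw [← h, ← h, hz, sub_self]

theorem core {N : ℕ} {Xl Xt : Set (Fin N → ℂ)} {V : Type} [AddCommGroup V] [Module ℚ V]
    {α : C(Dl 1, Xl) → V} {A : (Fin N → ℂ) → (Fin N → ℂ) → V} {S : Set (Fin N → ℂ)} {R0 R1 δ η δ' : ℝ}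
    (hR : R0 ≤ R1) (hη : 0 < η) (hδ' : 0 < δ') (hηδ : 3 * η ≤ δ) (hδδ : δ' ≤ δ)
    (hInt : ∀ σ : C(Dl 1, Xl), (∀ p, (σ p : Fin N → ℂ) ∈ S) → Int A σ (α σ))
    (hK1 : Xl ∩ {z | qq z ≤ R1} ⊆ S)
    (hstr : ∀ x ∈ Xl ∩ {z | qq z ≤ R1}, ∀ a ∈ S ∩ Metric.ball x δ, ∀ b ∈ S ∩ Metric.ball x δ,
      ∀ c ∈ S ∩ Metric.ball x δ, A a b + A b c = A a c)
    (hψ : ∀ z ∈ Xt, qq z ≤ R1 → ∃ x ∈ Xl ∩ {z | qq z ≤ R1}, dist z x < η)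
    (hball : ∀ x ∈ Xl ∩ {z | qq z ≤ R0}, ∀ y ∈ Metric.ball x η, qq y < R1)
    (hφ : ∀ x ∈ Xl ∩ {z | qq z ≤ R0}, ∃ y ∈ Xt, dist y x < δ' / 2)
    (hpath : ∀ x ∈ Xl ∩ {z | qq z ≤ R0}, ∀ a b : Xt, (a : Fin N → ℂ) ∈ Metric.ball x δ' →
      (b : Fin N → ℂ) ∈ Metric.ball x δ' →
      ∃ σ : C(Dl 1, Xt), src σ = a ∧ tgt σ = b ∧ ∀ p, (σ p : Fin N → ℂ) ∈ Metric.ball x η)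
    (hXt : IsClosed Xt) (hXt' : HasCharts Xt) :
    ∃ β : C(Dl 1, Xt) → V, Tri β ∧ ∀ z : C(Dl 1, Xl) →₀ ℚ, z.mapDomain tgt = z.mapDomain src →
      (∀ σ ∈ z.support, ∀ p, qq (σ p : Fin N → ℂ) ≤ R0) →
      ∃ w : C(Dl 1, Xt) →₀ ℚ, w.mapDomain tgt = w.mapDomain src ∧
        w.sum (fun σ q => q • β σ) = z.sum (fun σ q => q • α σ) := by
  classical
  have hψ' : ∀ z : Fin N → ℂ, ∃ x, z ∈ Xt → qq z ≤ R1 → x ∈ Xl ∩ {z | qq z ≤ R1} ∧ dist z x < η := by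
    intro z
    by_cases h : z ∈ Xt ∧ qq z ≤ R1
    · obtain ⟨x, h1, h2⟩ := hψ z h.1 h.2
      exact ⟨x, fun _ _ => ⟨h1, h2⟩⟩
    · exact ⟨0, fun h1 h2 => absurd ⟨h1, h2⟩ h⟩
  choose ψ hψ1 using hψ'
  let At : (Fin N → ℂ) → (Fin N → ℂ) → V := fun a b => A (ψ a) (ψ b)
  have hAt : IsCoc At (Xt ∩ {z | qq z < R1}) := by
    rintro z ⟨hz, hz2⟩
    have hz2 : qq z < R1 := hz2
    obtain ⟨h1, h2⟩ := hψ1 z hz hz2.le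
    have key : ∀ a ∈ (Xt ∩ {z | qq z < R1}) ∩ Metric.ball z η, ψ a ∈ S ∩ Metric.ball (ψ z) δ := by
      rintro a ⟨⟨ha, ha2⟩, ha3⟩
      obtain ⟨h3, h4⟩ := hψ1 a ha (le_of_lt ha2)
      refine ⟨hK1 h3, ?_⟩
      have ha3 : dist a z < η := ha3
      change dist (ψ a) (ψ z) < δ
      have := dist_triangle4 (ψ a) a z (ψ z)
      rw [dist_comm (ψ a) a] at this
      linarith
    exact ⟨_, inter_mem self_mem_nhdsWithin (mem_nhdsWithin_of_mem_nhds (Metric.ball_mem_nhds z hη)),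
      fun a ha b hb c hc => hstr _ h1 _ (key a ha) _ (key b hb) _ (key c hc)⟩
  obtain ⟨B, hB, hBA⟩ := extend hXt hXt' R1 At hAt
  choose β hβ using fun σ : C(Dl 1, Xt) => Int_exists hB σ
  have hTri : Tri β := fun τ => Int_tri hB τ (hβ _) (hβ _) (hβ _)
  refine ⟨β, hTri, ?_⟩
  let Z : Submodule ℚ (C(Dl 1, Xt) →₀ ℚ) :=
    LinearMap.ker (Finsupp.lmapDomain ℚ ℚ (tgt (X := Xt)) - Finsupp.lmapDomain ℚ ℚ src)
  let U : Submodule ℚ V := Z.map (Finsupp.linearCombination ℚ β)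
  have hZ : ∀ w : C(Dl 1, Xt) →₀ ℚ, w ∈ Z ↔ w.mapDomain tgt = w.mapDomain src := by
    intro w
    simp only [Z, LinearMap.mem_ker, LinearMap.sub_apply, sub_eq_zero, Finsupp.lmapDomain_apply]
  let π : V →ₗ[ℚ] (V ⧸ U) := U.mkQ
  obtain ⟨G, hG⟩ := potential (β := fun σ => π (β σ)) (by
    intro w hw
    have : w.sum (fun σ q => q • π (β σ)) = π (Finsupp.linearCombination ℚ β w) := by
      rw [Finsupp.linearCombination_apply, map_finsuppSum]
      simp
    rw [this]
    exact (Submodule.Quotient.mk_eq_zero U).2 ⟨w, (hZ w).2 hw, rfl⟩)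
  choose φ hφ1 hφ2 using hφ
  let G' : (Fin N → ℂ) → V ⧸ U := fun x =>
    if h : x ∈ Xl ∩ {z | qq z ≤ R0} then G ⟨φ x h, hφ1 x h⟩ + π (A (ψ (φ x h)) x) else 0
  have hK01 : Xl ∩ {z | qq z ≤ R0} ⊆ Xl ∩ {z | qq z ≤ R1} := fun z hz => ⟨hz.1, le_trans hz.2 hR⟩
  have hG' : IsPrim (fun a b => π (A a b)) G' (Xl ∩ {z | qq z ≤ R0}) := by
    intro x hx
    refine ⟨_, inter_mem self_mem_nhdsWithin (mem_nhdsWithin_of_mem_nhds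
      (Metric.ball_mem_nhds x (half_pos hδ'))), ?_⟩
    rintro a ⟨ha, ha2⟩ b ⟨hb, hb2⟩
    simp only [G', dif_pos ha, dif_pos hb]
    have ha2 : dist a x < δ' / 2 := ha2
    have hb2 : dist b x < δ' / 2 := hb2
    have da : dist (φ a ha) x < δ' := by
      have := dist_triangle (φ a ha) a x; have := hφ2 a ha; linarith
    have db : dist (φ b hb) x < δ' := by
      have := dist_triangle (φ b hb) b x; have := hφ2 b hb; linarith
    obtain ⟨σ, hs, ht, hσ⟩ := hpath x hx ⟨φ a ha, hφ1 a ha⟩ ⟨φ b hb, hφ1 b hb⟩ da db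
    have hσ1 : ∀ p, (σ p : Fin N → ℂ) ∈ Xt ∩ {z | qq z < R1} := fun p =>
      ⟨(σ p).2, hball x hx _ (hσ p)⟩
    have key : ∀ y ∈ (Xt ∩ {z | qq z < R1}) ∩ Metric.ball x η, ψ y ∈ S ∩ Metric.ball x δ := by
      rintro y ⟨⟨hy, hy2⟩, hy3⟩
      obtain ⟨h3, h4⟩ := hψ1 y hy (le_of_lt hy2)
      refine ⟨hK1 h3, ?_⟩
      have hy3 : dist y x < η := hy3
      change dist (ψ y) x < δ
      have := dist_triangle (ψ y) y x
      rw [dist_comm (ψ y) y] at this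
      linarith
    have hstr' := hstr x (hK01 hx)
    have hI := Int_strict (U := (Xt ∩ {z | qq z < R1}) ∩ Metric.ball x η) (Int_congr (hβ σ) hσ1 hBA.symm) (fun p => ⟨hσ1 p, hσ p⟩)
      (fun a ha b hb c hc => hstr' _ (key a ha) _ (key b hb) _ (key c hc))
    have hGσ := hG σ
    have sp : ∃ p, σ p = src σ := ⟨_, rfl⟩
    have tp : ∃ p, σ p = tgt σ := ⟨_, rfl⟩
    obtain ⟨p0, hp0⟩ := sp
    obtain ⟨p1, hp1⟩ := tp
    have ka := key _ ⟨hσ1 p0, hσ p0⟩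
    have kb := key _ ⟨hσ1 p1, hσ p1⟩
    rw [hp0, hs] at ka
    rw [hp1, ht] at kb
    rw [hs, ht] at hI hGσ
    simp only at hI hGσ ka kb
    change π (A a b) = _
    rw [hI] at hGσ
    have kaa : a ∈ S ∩ Metric.ball x δ := ⟨hK1 (hK01 ha), (by change dist a x < δ; linarith)⟩
    have kbb : b ∈ S ∩ Metric.ball x δ := ⟨hK1 (hK01 hb), (by change dist b x < δ; linarith)⟩
    have e1 := hstr' _ ka _ kaa _ kbb
    have e2 := hstr' _ ka _ kb _ kbb
    have e3 : A a b = At (φ a ha) (φ b hb) + A (ψ (φ b hb)) b - A (ψ (φ a ha)) a := by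
      simp only [At]
      rw [e2, ← e1]; abel
    rw [e3, map_sub, map_add, hGσ]
    abel
  intro z hz hsupp
  have hzz : π (z.sum (fun σ q => q • α σ)) = 0 := by
    rw [map_finsuppSum]
    rw [← pot_sum (G := fun x : Xl => G' x) z hz]
    apply Finsupp.sum_congr
    intro σ hσ
    have hσ1 : ∀ p, (σ p : Fin N → ℂ) ∈ Xl ∩ {z | qq z ≤ R0} := fun p => ⟨(σ p).2, hsupp σ hσ p⟩
    rw [map_smul]
    congr 1
    exact Int_prim hG' (Int_map π.toAddMonoidHom (hInt σ (fun p => hK1 (hK01 (hσ1 p))))) hσ1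
  obtain ⟨w, hw, hw2⟩ := (Submodule.Quotient.mk_eq_zero U).1 hzz
  refine ⟨w, (hZ w).1 hw, ?_⟩
  rw [← hw2, Finsupp.linearCombination_apply]

end AS
end
end

section
open Filter Set Topology
noncomputable section
namespace AS

def LProd {N n : ℕ} (M : Set (Fin N → ℂ)) (p : (Fin N → ℂ) → (Fin n → ℂ)) : Prop :=
  ∀ x ∈ M, ∃ (L : (Fin N → ℂ) →L[ℂ] ℂ) (Ω : Set (Fin N → ℂ)) (O : Set ((Fin n → ℂ) × ℂ))
      (Γ : (Fin n → ℂ) × ℂ → (Fin N → ℂ)), IsOpen Ω ∧ x ∈ Ω ∧ IsOpen O ∧ DifferentiableOn ℂ Γ O ∧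
      (∀ q ∈ O, Γ q ∈ M ∧ p (Γ q) = q.1 ∧ L (Γ q) = q.2) ∧
      (∀ z ∈ M ∩ Ω, (p z, L z) ∈ O ∧ Γ (p z, L z) = z)

variable {N n : ℕ} {M : Set (Fin N → ℂ)} {p : (Fin N → ℂ) → (Fin n → ℂ)}

theorem LProd.charts (h : LProd M p) (t : Fin n → ℂ) : HasCharts (M ∩ p ⁻¹' {t}) := by
  rintro x ⟨hx, hxt⟩
  obtain ⟨L, Ω, O, Γ, hΩ, hxΩ, hO, hΓ, h1, h2⟩ := h x hx
  have hc : Continuous (fun w : ℂ => (t, w)) := by fun_prop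
  have hd : Differentiable ℂ (fun w : ℂ => (t, w)) := by fun_prop
  refine ⟨L, Ω, (fun w => (t, w)) ⁻¹' O, fun w => Γ (t, w), hΩ, hxΩ, hO.preimage hc,
    hΓ.comp hd.differentiableOn (fun w hw => hw), ?_, ?_⟩
  · intro w hw
    obtain ⟨a, b, c⟩ := h1 _ hw
    exact ⟨⟨a, b⟩, c⟩
  · rintro z ⟨⟨hz, hzt⟩, hz2⟩
    have := h2 z ⟨hz, hz2⟩
    have hzt : p z = t := hzt
    rw [hzt] at this
    exact this

theorem exact_unif {X : Set (Fin N → ℂ)} (hX : HasCharts X) {V : Type} [AddCommGroup V]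
    {α : C(Dl 1, X) → V} (hα : Tri α) {K : Set (Fin N → ℂ)} (hK : IsCompact K) (hKX : K ⊆ X) :
    ∃ δ > 0, ∀ x ∈ K, ∃ g : (Fin N → ℂ) → V, ∀ σ : C(Dl 1, X),
      (∀ q, (σ q : Fin N → ℂ) ∈ Metric.ball x (2 * δ)) → α σ = g (tgt σ : X) - g (src σ : X) := by
  classical
  refine hK.induction_on (p := fun K => ∃ δ > 0, ∀ x ∈ K, ∃ g : (Fin N → ℂ) → V, ∀ σ : C(Dl 1, X),
      (∀ q, (σ q : Fin N → ℂ) ∈ Metric.ball x (2 * δ)) → α σ = g (tgt σ : X) - g (src σ : X)) ?_ ?_ ?_ ?_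
  · exact ⟨1, one_pos, by simp⟩
  · rintro s t hst ⟨δ, hδ, h⟩
    exact ⟨δ, hδ, fun x hx => h x (hst hx)⟩
  · rintro s t ⟨δ, hδ, h⟩ ⟨δ', hδ', h'⟩
    refine ⟨min δ δ', lt_min hδ hδ', ?_⟩
    rintro x (hx | hx)
    · obtain ⟨g, hg⟩ := h x hx
      refine ⟨g, fun σ hσ => hg σ fun q => Metric.ball_subset_ball ?_ (hσ q)⟩
      have := min_le_left δ δ'; linarith
    · obtain ⟨g, hg⟩ := h' x hx
      refine ⟨g, fun σ hσ => hg σ fun q => Metric.ball_subset_ball ?_ (hσ q)⟩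
      have := min_le_right δ δ'; linarith
  · intro x hxK
    have hx := hKX hxK
    obtain ⟨L, Ω, O, γ, hΩ, hxΩ, hO, hγ, h1, h2⟩ := hX x hx
    obtain ⟨hw, hγx⟩ := h2 x ⟨hx, hxΩ⟩
    obtain ⟨r, hr, hrO⟩ := Metric.isOpen_iff.1 hO _ hw
    have hU : IsOpen (Ω ∩ L ⁻¹' Metric.ball (L x) r) := hΩ.inter (Metric.isOpen_ball.preimage L.continuous)
    obtain ⟨e, he, heU⟩ := Metric.isOpen_iff.1 hU x ⟨hxΩ, Metric.mem_ball_self hr⟩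
    let γ' : ℂ → X := fun w => if h : γ w ∈ X then ⟨γ w, h⟩ else ⟨x, hx⟩
    have hγ' : ∀ w ∈ O, (γ' w : Fin N → ℂ) = γ w := by
      intro w hw
      simp only [γ', dif_pos (h1 w hw).1]
    have hγc : ContinuousOn γ' (Metric.ball (L x) r) := by
      have : ContinuousOn (fun w => (γ' w : Fin N → ℂ)) (Metric.ball (L x) r) :=
        (hγ.continuousOn.mono hrO).congr (fun w hw => hγ' w (hrO hw))
      exact Topology.IsInducing.subtypeVal.continuousOn_iff.2 this
    obtain ⟨g, hg⟩ := cone (X := X) (convex_ball (L x) r) (Metric.mem_ball_self hr)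
      (T := {z : X | (z : Fin N → ℂ) ∈ Ω ∩ L ⁻¹' Metric.ball (L x) r}) γ' hγc
      (fun z => L z) (by fun_prop) (fun z hz => hz.2)
      (fun z hz => by
        apply Subtype.ext
        rw [hγ' _ (hrO hz.2)]
        exact (h2 z ⟨z.2, hz.1⟩).2) hα
    refine ⟨Metric.ball x (e / 3), mem_nhdsWithin_of_mem_nhds (Metric.ball_mem_nhds _ (by positivity)),
      e / 3, by positivity, ?_⟩
    intro y hy
    refine ⟨fun z => if h : z ∈ X then g ⟨z, h⟩ else 0, fun σ hσ => ?_⟩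
    rw [hg σ]
    · simp
    · intro q
      refine heU ?_
      have h1 : dist (σ q : Fin N → ℂ) y < 2 * (e / 3) := hσ q
      have h2 : dist y x < e / 3 := hy
      change dist (σ q : Fin N → ℂ) x < e
      have := dist_triangle (σ q : Fin N → ℂ) y x
      linarith

theorem LProd.paths (h : LProd M p) {lam : Fin n → ℂ} {K : Set (Fin N → ℂ)} (hK : IsCompact K)
    (hKX : K ⊆ M ∩ p ⁻¹' {lam}) {δ : ℝ} (hδ : 0 < δ) :
    ∃ δ' > 0, ∃ D ∈ 𝓝 lam, ∀ x ∈ K, ∀ t ∈ D, ∀ a b : ↥(M ∩ p ⁻¹' {t}),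
      (a : Fin N → ℂ) ∈ Metric.ball x δ' → (b : Fin N → ℂ) ∈ Metric.ball x δ' →
      ∃ σ : C(Dl 1, ↥(M ∩ p ⁻¹' {t})), src σ = a ∧ tgt σ = b ∧
        ∀ q, (σ q : Fin N → ℂ) ∈ Metric.ball x δ := by
  refine hK.induction_on (p := fun K => ∃ δ' > 0, ∃ D ∈ 𝓝 lam, ∀ x ∈ K, ∀ t ∈ D, ∀ a b : ↥(M ∩ p ⁻¹' {t}),
      (a : Fin N → ℂ) ∈ Metric.ball x δ' → (b : Fin N → ℂ) ∈ Metric.ball x δ' →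
      ∃ σ : C(Dl 1, ↥(M ∩ p ⁻¹' {t})), src σ = a ∧ tgt σ = b ∧
        ∀ q, (σ q : Fin N → ℂ) ∈ Metric.ball x δ) ?_ ?_ ?_ ?_
  · exact ⟨1, one_pos, univ, univ_mem, by simp⟩
  · rintro s t hst ⟨δ, hδ, D, hD, h⟩
    exact ⟨δ, hδ, D, hD, fun x hx => h x (hst hx)⟩
  · rintro s t ⟨δ1, hδ1, D, hD, h⟩ ⟨δ2, hδ2, D', hD', h'⟩
    refine ⟨min δ1 δ2, lt_min hδ1 hδ2, D ∩ D', inter_mem hD hD', ?_⟩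
    rintro x (hx | hx) t ht a b ha hb
    · exact h x hx t ht.1 a b (Metric.ball_subset_ball (min_le_left _ _) ha)
        (Metric.ball_subset_ball (min_le_left _ _) hb)
    · exact h' x hx t ht.2 a b (Metric.ball_subset_ball (min_le_right _ _) ha)
        (Metric.ball_subset_ball (min_le_right _ _) hb)
  · intro x hxK
    obtain ⟨hx, hxl⟩ := hKX hxK
    have hxl : p x = lam := hxl
    obtain ⟨L, Ω, O, Γ, hΩ, hxΩ, hO, hΓ, h1, h2⟩ := h x hx
    obtain ⟨hw, hΓx⟩ := h2 x ⟨hx, hxΩ⟩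
    rw [hxl] at hw hΓx
    have hU : IsOpen (O ∩ Γ ⁻¹' Metric.ball x (δ / 2)) :=
      hΓ.continuousOn.isOpen_inter_preimage hO Metric.isOpen_ball
    obtain ⟨r, hr, hrU⟩ := Metric.isOpen_iff.1 hU (lam, L x)
      ⟨hw, by rw [mem_preimage, hΓx]; exact Metric.mem_ball_self (by positivity)⟩
    rw [← ball_prod_same] at hrU
    have hU2 : IsOpen (Ω ∩ L ⁻¹' Metric.ball (L x) r) := hΩ.inter (Metric.isOpen_ball.preimage L.continuous)
    obtain ⟨e, he, heU⟩ := Metric.isOpen_iff.1 hU2 x ⟨hxΩ, Metric.mem_ball_self hr⟩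
    set η := min (e / 2) (δ / 2) with hη
    have hη0 : 0 < η := lt_min (by positivity) (by positivity)
    have hη1 : η ≤ e / 2 := min_le_left _ _
    have hη2 : η ≤ δ / 2 := min_le_right _ _
    refine ⟨Metric.ball x η, mem_nhdsWithin_of_mem_nhds (Metric.ball_mem_nhds _ hη0),
      η, hη0, Metric.ball lam r, Metric.ball_mem_nhds _ hr, ?_⟩
    intro y hy t ht a b ha hb
    have hy : dist y x < η := hy
    have hball : ∀ z ∈ Metric.ball y η, z ∈ Ω ∩ L ⁻¹' Metric.ball (L x) r := by
      intro z hz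
      apply heU
      have hz : dist z y < η := hz
      change dist z x < e
      have := dist_triangle z y x
      linarith
    have hseg : ∀ q : Dl 1, (t, q.1 0 • L a + q.1 1 • L b) ∈ Metric.ball lam r ×ˢ Metric.ball (L x) r := by
      intro q
      refine ⟨ht, ?_⟩
      refine convex_ball (L x) r (hball _ ha).2 (hball _ hb).2 (q.2.1 0) (q.2.1 1) ?_
      have := q.2.2
      rwa [Fin.sum_univ_two] at this
    have hfib : ∀ q : Dl 1, Γ (t, q.1 0 • L a + q.1 1 • L b) ∈ M ∩ p ⁻¹' {t} := by
      intro q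
      obtain ⟨c1, c2, _⟩ := h1 _ (hrU (hseg q)).1
      exact ⟨c1, c2⟩
    have hcont : Continuous (fun q : Dl 1 => Γ (t, q.1 0 • L a + q.1 1 • L b)) := by
      refine hΓ.continuousOn.comp_continuous ?_ (fun q => (hrU (hseg q)).1)
      exact continuous_const.prodMk (((cc 1 0).smul continuous_const).add ((cc 1 1).smul continuous_const))
    refine ⟨⟨fun q => ⟨_, hfib q⟩, hcont.subtype_mk _⟩, ?_, ?_, ?_⟩
    · apply Subtype.ext
      simp only [src, ContinuousMap.coe_mk, vx]
      have := (h2 a ⟨a.2.1, (hball _ ha).1⟩).2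
      have hpa : p a = t := a.2.2
      rw [hpa] at this
      simpa using this
    · apply Subtype.ext
      simp only [tgt, ContinuousMap.coe_mk, vx]
      have := (h2 b ⟨b.2.1, (hball _ hb).1⟩).2
      have hpb : p b = t := b.2.2
      rw [hpb] at this
      simpa using this
    · intro q
      have h3 : dist (Γ (t, q.1 0 • L a + q.1 1 • L b)) x < δ / 2 := (hrU (hseg q)).2
      change dist (Γ (t, q.1 0 • L a + q.1 1 • L b)) y < δ
      have := dist_triangle (Γ (t, q.1 0 • L a + q.1 1 • L b)) x y
      rw [dist_comm x y] at this
      linarith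

theorem LProd.near (h : LProd M p) {lam : Fin n → ℂ} {K : Set (Fin N → ℂ)} (hK : IsCompact K)
    (hKX : K ⊆ M ∩ p ⁻¹' {lam}) {δ : ℝ} (hδ : 0 < δ) :
    ∃ D ∈ 𝓝 lam, ∀ x ∈ K, ∀ t ∈ D, ∃ y ∈ M ∩ p ⁻¹' {t}, dist y x < δ := by
  refine hK.induction_on (p := fun K => ∃ D ∈ 𝓝 lam, ∀ x ∈ K, ∀ t ∈ D, ∃ y ∈ M ∩ p ⁻¹' {t}, dist y x < δ)
    ?_ ?_ ?_ ?_
  · exact ⟨univ, univ_mem, by simp⟩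
  · rintro s t hst ⟨D, hD, h⟩
    exact ⟨D, hD, fun x hx => h x (hst hx)⟩
  · rintro s t ⟨D, hD, h⟩ ⟨D', hD', h'⟩
    refine ⟨D ∩ D', inter_mem hD hD', ?_⟩
    rintro x (hx | hx) t ht
    · exact h x hx t ht.1
    · exact h' x hx t ht.2
  · intro x hxK
    obtain ⟨hx, hxl⟩ := hKX hxK
    have hxl : p x = lam := hxl
    obtain ⟨L, Ω, O, Γ, hΩ, hxΩ, hO, hΓ, h1, h2⟩ := h x hx
    obtain ⟨hw, hΓx⟩ := h2 x ⟨hx, hxΩ⟩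
    rw [hxl] at hw hΓx
    have hU : IsOpen (O ∩ Γ ⁻¹' Metric.ball x (δ / 2)) :=
      hΓ.continuousOn.isOpen_inter_preimage hO Metric.isOpen_ball
    have hc : Continuous (fun t : Fin n → ℂ => (t, L x)) := by fun_prop
    refine ⟨Metric.ball x (δ / 2), mem_nhdsWithin_of_mem_nhds (Metric.ball_mem_nhds _ (by positivity)),
      _, (hU.preimage hc).mem_nhds ⟨hw, by rw [mem_preimage, hΓx]; exact Metric.mem_ball_self (by positivity)⟩, ?_⟩
    intro y hy t ht
    obtain ⟨c1, c2, _⟩ := h1 _ ht.1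
    refine ⟨_, ⟨c1, c2⟩, ?_⟩
    have h3 : dist (Γ (t, L x)) x < δ / 2 := ht.2
    have h4 : dist y x < δ / 2 := hy
    have := dist_triangle (Γ (t, L x)) x y
    rw [dist_comm x y] at this
    linarith

theorem far (hM : IsClosed M) (hp : ContinuousOn p M) (lam : Fin n → ℂ) (R : ℝ) {η : ℝ} (hη : 0 < η) :
    ∃ D ∈ 𝓝 lam, ∀ t ∈ D, ∀ z ∈ M ∩ p ⁻¹' {t}, qq z ≤ R →
      ∃ x ∈ (M ∩ p ⁻¹' {lam}) ∩ {z | qq z ≤ R}, dist z x < η := by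
  let U := ⋃ x ∈ (M ∩ p ⁻¹' {lam}) ∩ {z | qq z ≤ R}, Metric.ball x η
  have hU : IsOpen U := isOpen_biUnion (fun x _ => Metric.isOpen_ball)
  have hC := (qq_compact hM R).diff hU
  have hC2 := hC.image_of_continuousOn (hp.mono (fun z hz => hz.1.1))
  refine ⟨_, hC2.isClosed.isOpen_compl.mem_nhds (x := lam) ?_, ?_⟩
  · rintro ⟨z, ⟨⟨hz, hz2⟩, hz3⟩, hzl⟩
    exact hz3 (mem_biUnion (⟨⟨hz, hzl⟩, hz2⟩ : z ∈ (M ∩ p ⁻¹' {lam}) ∩ {z | qq z ≤ R})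
      (Metric.mem_ball_self hη))
  · intro t ht z hz hzR
    by_contra hcon
    apply ht
    refine ⟨z, ⟨⟨hz.1, hzR⟩, ?_⟩, hz.2⟩
    intro hzU
    obtain ⟨x, hx, hx2⟩ := mem_iUnion₂.1 hzU
    exact hcon ⟨x, hx, hx2⟩

end AS
end
end

section
open Filter Set Topology
noncomputable section
namespace AS

theorem main {N n : ℕ} {M : Set (Fin N → ℂ)} {p : (Fin N → ℂ) → (Fin n → ℂ)} (hM : IsClosed M)
    (hp : ContinuousOn p M) (h : LProd M p) (lam : Fin n → ℂ)
    (hfin : FiniteBetti ↥(M ∩ p ⁻¹' {lam}) 1) :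
    ∃ D ∈ 𝓝 lam, ∀ t ∈ D, FiniteBetti ↥(M ∩ p ⁻¹' {t}) 1 →
      bettiNumber ↥(M ∩ p ⁻¹' {lam}) 1 ≤ bettiNumber ↥(M ∩ p ⁻¹' {t}) 1 := by
  classical
  have hcl : ∀ t, IsClosed (M ∩ p ⁻¹' {t}) := fun t => hp.preimage_isClosed_of_isClosed hM isClosed_singleton
  obtain ⟨α, hα, hsurj⟩ := bridge2 ↥(M ∩ p ⁻¹' {lam})
  have : FiniteDimensional ℚ (singularHomology ↥(M ∩ p ⁻¹' {lam}) 1) := hfin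
  obtain ⟨F, hF⟩ := Module.Finite.fg_top (R := ℚ) (M := singularHomology ↥(M ∩ p ⁻¹' {lam}) 1)
  choose z hz1 hz2 using hsurj
  -- bound
  have hbd : ∃ R0 : ℝ, ∀ v ∈ F, ∀ σ ∈ (z v).support, ∀ q, qq (σ q : Fin N → ℂ) ≤ R0 := by
    have : ∀ σ : C(Dl 1, ↥(M ∩ p ⁻¹' {lam})), ∃ R : ℝ, ∀ q, qq (σ q : Fin N → ℂ) ≤ R := by
      intro σ
      have hc : Continuous (fun q => qq (σ q : Fin N → ℂ)) :=
        (qq_cont N).comp (continuous_subtype_val.comp σ.continuous)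
      obtain ⟨R, hR⟩ := (isCompact_range hc).bddAbove
      exact ⟨R, fun q => hR (mem_range_self q)⟩
    choose R hR using this
    obtain ⟨R0, hR0⟩ := ((F.biUnion fun v => (z v).support).image R).bddAbove
    refine ⟨R0, fun v hv σ hσ q => (hR σ q).trans (hR0 ?_)⟩
    simp only [Finset.coe_image]
    exact ⟨σ, Finset.mem_biUnion.2 ⟨v, hv, hσ⟩, rfl⟩
  obtain ⟨R0, hR0⟩ := hbd
  have hK : ∀ R, IsCompact ((M ∩ p ⁻¹' {lam}) ∩ {z | qq z ≤ R}) := fun R => qq_compact (hcl lam) R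
  have hKX : ∀ R, (M ∩ p ⁻¹' {lam}) ∩ {z | qq z ≤ R} ⊆ M ∩ p ⁻¹' {lam} := fun R => inter_subset_left
  obtain ⟨δ0, hδ0, H1⟩ := exact_unif (h.charts lam) hα (hK (R0 + 2)) (hKX _)
  obtain ⟨δ1, hδ1, D1, hD1, H2⟩ := h.paths (hK (R0 + 2)) (hKX _) hδ0
  have hSK : (M ∩ p ⁻¹' {lam}) ∩ {z | qq z < R0 + 2} ⊆ (M ∩ p ⁻¹' {lam}) ∩ {z | qq z ≤ R0 + 2} := fun z hz => ⟨hz.1, (show qq z < R0 + 2 from hz.2).le⟩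
  obtain ⟨A, hA, hInt⟩ := coc_of_tri (X := M ∩ p ⁻¹' {lam}) hα (S := (M ∩ p ⁻¹' {lam}) ∩ {z | qq z < R0 + 2}) hδ0 hδ1 inter_subset_left
    (fun x hx => H1 x (hSK hx)) (fun x hx a b => H2 x (hSK hx) lam (mem_of_mem_nhds hD1) a b)
  have hK1 : (M ∩ p ⁻¹' {lam}) ∩ {z | qq z ≤ R0 + 1} ⊆ (M ∩ p ⁻¹' {lam}) ∩ {z | qq z < R0 + 2} := fun z hz =>
    ⟨hz.1, lt_of_le_of_lt (show qq z ≤ R0 + 1 from hz.2) (by linarith)⟩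
  obtain ⟨δ, hδ, hstr⟩ := hA.unif (hK (R0 + 1)) hK1
  have hb : ∃ η1 > 0, ∀ x ∈ (M ∩ p ⁻¹' {lam}) ∩ {z | qq z ≤ R0}, ∀ y ∈ Metric.ball x η1, qq y < R0 + 1 := by
    obtain ⟨η1, hη1, hs⟩ := (hK R0).exists_thickening_subset_open
      (isOpen_lt (qq_cont N) continuous_const : IsOpen {z | qq z < R0 + 1})
      (fun z hz => lt_of_le_of_lt (show qq z ≤ R0 from hz.2) (by linarith))
    refine ⟨η1, hη1, fun x hx y hy => hs (Metric.mem_thickening_iff.2 ⟨x, hx, hy⟩)⟩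
  obtain ⟨η1, hη1, hball⟩ := hb
  set η := min (δ / 3) η1 with hηd
  have hη : 0 < η := lt_min (by positivity) hη1
  have hηδ : η ≤ δ / 3 := min_le_left _ _
  obtain ⟨δ2, hδ2, D2, hD2, H3⟩ := h.paths (hK R0) (hKX _) hη
  set δ' := min δ2 δ with hδd
  have hδ' : 0 < δ' := lt_min hδ2 hδ
  obtain ⟨D3, hD3, H4⟩ := h.near (hK R0) (hKX _) (half_pos hδ')
  obtain ⟨D4, hD4, H5⟩ := far hM hp lam (R0 + 1) hη
  refine ⟨D2 ∩ D3 ∩ D4, inter_mem (inter_mem hD2 hD3) hD4, ?_⟩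
  rintro t ⟨⟨ht2, ht3⟩, ht4⟩ hfint
  obtain ⟨β, hβ, hw⟩ := core (Xl := M ∩ p ⁻¹' {lam}) (Xt := M ∩ p ⁻¹' {t}) (α := α) (A := A) (R0 := R0) (R1 := R0 + 1)
    (δ := δ) (η := η) (δ' := δ') (by linarith) hη hδ' (by linarith) (min_le_right _ _) hInt hK1 hstr
    (H5 t ht4) (fun x hx y hy => hball x hx y (Metric.ball_subset_ball (min_le_right _ _) hy))
    (fun x hx => H4 x hx t ht3)
    (fun x hx a b ha hb => H3 x hx t ht2 a b (Metric.ball_subset_ball (min_le_left _ _) ha)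
      (Metric.ball_subset_ball (min_le_left _ _) hb))
    (hcl t) (h.charts t)
  refine bridge1 _ β hβ hfint ?_
  let Z : Submodule ℚ (C(Dl 1, ↥(M ∩ p ⁻¹' {t})) →₀ ℚ) :=
    LinearMap.ker (Finsupp.lmapDomain ℚ ℚ (tgt (X := ↥(M ∩ p ⁻¹' {t}))) - Finsupp.lmapDomain ℚ ℚ src)
  have hZ : ∀ w, w ∈ Z ↔ w.mapDomain tgt = w.mapDomain src := by
    intro w
    simp only [Z, LinearMap.mem_ker, LinearMap.sub_apply, sub_eq_zero, Finsupp.lmapDomain_apply]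
  have htop : (⊤ : Submodule ℚ _) ≤ Z.map (Finsupp.linearCombination ℚ β) := by
    rw [← hF, Submodule.span_le]
    intro v hv
    obtain ⟨w, hw1, hw2⟩ := hw (z v) (hz1 v) (hR0 v hv)
    refine ⟨w, (hZ w).2 hw1, ?_⟩
    rw [Finsupp.linearCombination_apply, hw2, hz2]
  intro v
  obtain ⟨w, hw1, hw2⟩ := htop (Submodule.mem_top (x := v))
  exact ⟨w, (hZ w).1 hw1, by rw [← hw2, Finsupp.linearCombination_apply]⟩

end AS

end
end

/-- For a holomorphic submersion `p : M → B` from a connected Stein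
manifold `M ⊆ ℂ^N` of dimension `n+1` to a connected open `B ⊆ ℂ^n`, with finite Betti
numbers `b₀(t)`, `b₁(t)` of all the fibres, the top Betti number `t ↦ b₁(t)` is lower
semi-continuous. -/
theorem statement4 (N n : ℕ) (hn : 1 ≤ n) (hNn : n + 1 ≤ N)
    (M : Set (Fin N → ℂ)) (hMstein : IsSteinSubmanifold N (n + 1) M)
    (hMconn : IsConnected M)
    (B : Set (Fin n → ℂ)) (hBopen : IsOpen B) (hBconn : IsConnected B)
    (p : (Fin N → ℂ) → (Fin n → ℂ))
    (hphol : ∃ U, IsOpen U ∧ M ⊆ U ∧ DifferentiableOn ℂ p U)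
    (hpmaps : Set.MapsTo p M B)
    (hsub : ∀ x ∈ M, SubmersionAt (N - (n + 1)) M p x)
    (hbetti : ∀ t ∈ B, FiniteBetti ↥(M ∩ p ⁻¹' {t}) 0 ∧ FiniteBetti ↥(M ∩ p ⁻¹' {t}) 1) :
    ∀ lam ∈ B, ∃ B' : Set (Fin n → ℂ), IsOpen B' ∧ lam ∈ B' ∧ B' ⊆ B ∧
      ∀ t ∈ B', bettiNumber ↥(M ∩ p ⁻¹' {lam}) 1 ≤ bettiNumber ↥(M ∩ p ⁻¹' {t}) 1 := by
  intro lam hlam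
  have hp : ContinuousOn p M := by
    obtain ⟨U, _, hMU, hd⟩ := hphol
    exact hd.continuousOn.mono hMU
  have hL : AS.LProd M p := fun x hx => AS.local_product hNn hphol hx (hsub x hx)
  obtain ⟨D, hD, h⟩ := AS.main hMstein.1 hp hL lam (hbetti lam hlam).2
  obtain ⟨D', hD', hDo, hlD⟩ := mem_nhds_iff.1 hD
  exact ⟨D' ∩ B, hDo.inter hBopen, ⟨hlD, hlam⟩, inter_subset_right,
    fun t ht => h t (hD' ht.1) (hbetti t ht.2).2⟩

end
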